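/- arXiv:1410.6779 — 2 statements merged into one kernel-verified Lean document; each statement's English description precedes it below -/
import Mathlib

section
/- Let N ≥ 2 be an integer, Ω ⊂ ℝ^N a bounded open set, C_0 ≥ 1, and V : Ω → ℝ measurable with 1/C_0 ≤ V(x) ≤ C_0 on Ω. Let m ≥ 1 be an integer and λ ∈ (c_N m, c_N (m+1)). Then for any ε ∈ (0,1) and r ∈ (0,1) there exists L > 0 such that for every C¹ function u : ℝ^N → ℝ with compact support contained in Ω satisfying (1/N)∫_Ω |∇u|^N dx − λ log(∫_Ω V e^u dx) ≤ −L, there exist m points p_1, …, p_m in the closure of Ω with ∫_{Ω ∖ ⋃_{i=1}^{m} B_r(p_i)} V e^u dx ≤ ε ∫_Ω V e^u dx. -/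
open MeasureTheory Real Metric Set
open scoped ENNReal

noncomputable def omegaN (N : ℕ) : ℝ :=
  (volume (Metric.ball (0 : EuclideanSpace ℝ (Fin N)) 1)).toReal

noncomputable def cN (N : ℕ) : ℝ :=
  N * ((N : ℝ) ^ 2 / ((N : ℝ) - 1)) ^ (N - 1) * omegaN N

theorem omegaN_pos (N : ℕ) : 0 < omegaN N :=
  ENNReal.toReal_pos (measure_ball_pos _ _ one_pos).ne' measure_ball_lt_top.ne

theorem ofReal_omegaN (N : ℕ) :
    ENNReal.ofReal (omegaN N) = volume (ball (0 : EuclideanSpace ℝ (Fin N)) 1) :=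
  ENNReal.ofReal_toReal measure_ball_lt_top.ne

/-- Integration of a radial function in polar coordinates. -/
theorem lintegral_fun_norm {N : ℕ} (hN : 2 ≤ N) {f : ℝ → ℝ≥0∞} (hf : Measurable f) :
    ∫⁻ x : EuclideanSpace ℝ (Fin N), f ‖x‖ =
      ENNReal.ofReal (N * omegaN N) * ∫⁻ y in Ioi (0 : ℝ), ENNReal.ofReal (y ^ (N - 1)) * f y := by
  have : Nonempty (Fin N) := ⟨⟨0, by omega⟩⟩
  have hd : Module.finrank ℝ (EuclideanSpace ℝ (Fin N)) = N := by simp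
  set μ : Measure (EuclideanSpace ℝ (Fin N)) := volume
  calc
    ∫⁻ x, f ‖x‖ ∂μ
      = ∫⁻ x : ({(0)}ᶜ : Set (EuclideanSpace ℝ (Fin N))), f ‖x.1‖ ∂(μ.comap (↑)) := by
      rw [lintegral_subtype_comap (measurableSet_singleton _).compl fun x ↦ f (‖x‖),
        restrict_compl_singleton]
    _ = ∫⁻ x, f x.2 ∂μ.toSphere.prod (.volumeIoiPow (N - 1)) := by
      have h := μ.measurePreserving_homeomorphUnitSphereProd
      rw [hd] at h
      simpa using h.lintegral_comp_emb
        (Homeomorph.measurableEmbedding _) (f ∘ Subtype.val ∘ Prod.snd)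
    _ = μ.toSphere univ * ∫⁻ x : Ioi (0 : ℝ), f x ∂.volumeIoiPow (N - 1) := by
      rw [lintegral_prod _ (by fun_prop)]
      simp [mul_comm]
    _ = _ := by
      rw [μ.toSphere_apply_univ, hd, ENNReal.ofReal_mul (by positivity), ofReal_omegaN,
        ENNReal.ofReal_natCast]
      congr 1
      rw [Measure.volumeIoiPow, lintegral_withDensity_eq_lintegral_mul _ (by fun_prop)
        (by fun_prop)]
      exact lintegral_subtype_comap measurableSet_Ioi fun a ↦ ENNReal.ofReal (a ^ (N - 1)) * f a

/-- The kernel `|y|^(1-N)`. -/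
noncomputable def rieszKernel (N : ℕ) (y : EuclideanSpace ℝ (Fin N)) : ℝ≥0∞ :=
  ENNReal.ofReal ((‖y‖ ^ (N - 1))⁻¹)

@[fun_prop]
theorem measurable_rieszKernel (N : ℕ) : Measurable (rieszKernel N) := by
  unfold rieszKernel; fun_prop

theorem setLIntegral_ball_rieszKernel {N : ℕ} (hN : 2 ≤ N) (ρ : ℝ) :
    ∫⁻ y in ball 0 ρ, rieszKernel N y = ENNReal.ofReal (N * omegaN N * ρ) := by
  have h1 : ∀ y : EuclideanSpace ℝ (Fin N), (ball 0 ρ).indicator (rieszKernel N) y =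
      (Iio ρ).indicator (fun t : ℝ ↦ ENNReal.ofReal ((t ^ (N - 1))⁻¹)) ‖y‖ := by
    intro y
    simp [indicator, rieszKernel]
  rw [← lintegral_indicator measurableSet_ball]
  simp_rw [h1]
  rw [lintegral_fun_norm hN (Measurable.indicator (by fun_prop) measurableSet_Iio),
    ENNReal.ofReal_mul (mul_nonneg (by positivity) (omegaN_pos N).le)]
  congr 1
  have h2 : ∀ y ∈ Ioi (0 : ℝ), ENNReal.ofReal (y ^ (N - 1)) *
      (Iio ρ).indicator (fun t : ℝ ↦ ENNReal.ofReal ((t ^ (N - 1))⁻¹)) y =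
      (Iio ρ).indicator (fun _ ↦ 1) y := by
    intro y hy
    by_cases h : y ∈ Iio ρ
    · rw [indicator_of_mem h, indicator_of_mem h, ← ENNReal.ofReal_mul (pow_nonneg hy.out.le _),
        mul_inv_cancel₀ (pow_pos hy.out _).ne', ENNReal.ofReal_one]
    · simp [indicator_of_notMem h]
  rw [setLIntegral_congr_fun measurableSet_Ioi h2, lintegral_indicator measurableSet_Iio,
    Measure.restrict_restrict measurableSet_Iio, Set.inter_comm, Ioi_inter_Iio]
  simp

theorem setLIntegral_annulus_rieszKernel_rpow {N : ℕ} (hN : 2 ≤ N) {ρ R : ℝ} (hρ : 0 < ρ)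
    (hR : ρ ≤ R) :
    ∫⁻ y in ball 0 R \ ball 0 ρ, rieszKernel N y ^ ((N : ℝ) / (N - 1)) =
      ENNReal.ofReal (N * omegaN N * log (R / ρ)) := by
  have hN' : (2 : ℝ) ≤ N := by exact_mod_cast hN
  have h1 : ∀ y : EuclideanSpace ℝ (Fin N),
      (ball 0 R \ ball 0 ρ).indicator (fun y ↦ rieszKernel N y ^ ((N : ℝ) / (N - 1))) y =
      (Ico ρ R).indicator (fun t : ℝ ↦ ENNReal.ofReal ((t ^ N)⁻¹)) ‖y‖ := by
    intro y
    by_cases h : ‖y‖ ∈ Ico ρ R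
    · rw [indicator_of_mem h, indicator_of_mem (by simpa [and_comm] using h), rieszKernel,
        ENNReal.ofReal_rpow_of_nonneg (by positivity) (by apply div_nonneg <;> linarith)]
      congr 1
      rw [Real.inv_rpow (by positivity), ← Real.rpow_natCast, ← Real.rpow_mul (by positivity),
        ← Real.rpow_natCast]
      congr 2
      rw [Nat.cast_sub (by omega)]
      push_cast
      field_simp [show (N : ℝ) - 1 ≠ 0 by linarith]
    · rw [indicator_of_notMem h, indicator_of_notMem (by simpa [and_comm] using h)]
  rw [← lintegral_indicator (measurableSet_ball.diff measurableSet_ball)]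
  simp_rw [h1]
  rw [lintegral_fun_norm hN (Measurable.indicator (by fun_prop) measurableSet_Ico),
    ENNReal.ofReal_mul (mul_nonneg (by positivity) (omegaN_pos N).le)]
  congr 1
  have h2 : ∀ y ∈ Ioi (0 : ℝ), ENNReal.ofReal (y ^ (N - 1)) *
      (Ico ρ R).indicator (fun t : ℝ ↦ ENNReal.ofReal ((t ^ N)⁻¹)) y =
      (Ico ρ R).indicator (fun t ↦ ENNReal.ofReal t⁻¹) y := by
    intro y hy
    have hy0 : 0 < y := hy
    by_cases h : y ∈ Ico ρ R
    · rw [indicator_of_mem h, indicator_of_mem h, ← ENNReal.ofReal_mul (pow_nonneg hy.out.le _)]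
      congr 1
      rw [← Nat.sub_add_cancel (show 1 ≤ N by omega), pow_succ, Nat.add_sub_cancel]
      field_simp
    · simp [indicator_of_notMem h]
  rw [setLIntegral_congr_fun measurableSet_Ioi h2, lintegral_indicator measurableSet_Ico,
    Measure.restrict_restrict measurableSet_Ico,
    show Ico ρ R ∩ Ioi 0 = Ico ρ R from inter_eq_left.2 fun x hx ↦ hρ.trans_le hx.1,
    ← integral_inv_of_pos hρ (hρ.trans_le hR),
    intervalIntegral.integral_of_le hR, ofReal_integral_eq_lintegral_ofReal,
    Measure.restrict_congr_set Ico_ae_eq_Ioc]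
  · rw [← IntegrableOn, ← intervalIntegrable_iff_integrableOn_Ioc_of_le hR,
      intervalIntegrable_inv_iff]
    right
    rw [uIcc_of_le hR]
    exact fun h ↦ absurd h.1 (not_le.2 hρ)
  · filter_upwards [ae_restrict_mem measurableSet_Ioc] with x hx
    exact inv_nonneg.2 (hρ.trans hx.1).le

theorem lintegral_comp_smul_pos {N : ℕ} {g : EuclideanSpace ℝ (Fin N) → ℝ≥0∞}
    (hg : Measurable g) {τ : ℝ} (hτ : 0 < τ) :
    ∫⁻ z, g (τ • z) = ENNReal.ofReal ((τ ^ N)⁻¹) * ∫⁻ w, g w := by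
  have h := Measure.map_addHaar_smul (volume : Measure (EuclideanSpace ℝ (Fin N))) hτ.ne'
  rw [← lintegral_map hg (by fun_prop : Measurable fun z : EuclideanSpace ℝ (Fin N) ↦ τ • z), h,
    lintegral_smul_measure, finrank_euclideanSpace, Fintype.card_fin,
    abs_of_nonneg (by positivity), smul_eq_mul]

theorem enorm_sub_le_lintegral_fderiv {N : ℕ} {u : EuclideanSpace ℝ (Fin N) → ℝ}
    (hu : ContDiff ℝ 1 u) (x z : EuclideanSpace ℝ (Fin N)) :
    ‖u (x + z) - u x‖ₑ ≤ ∫⁻ τ in Ioc (0 : ℝ) 1, ‖fderiv ℝ u (x + τ • z)‖ₑ * ‖z‖ₑ := by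
  have hd : ∀ τ : ℝ, HasDerivAt (fun τ : ℝ ↦ u (x + τ • z)) (fderiv ℝ u (x + τ • z) z) τ := by
    intro τ
    have h1 : HasDerivAt (fun τ : ℝ ↦ x + τ • z) z τ := by
      simpa using ((hasDerivAt_id τ).smul_const z).const_add x
    exact ((hu.differentiable one_ne_zero) _).hasFDerivAt.comp_hasDerivAt τ h1
  have hc : Continuous fun τ : ℝ ↦ fderiv ℝ u (x + τ • z) z := by
    have := hu.continuous_fderiv one_ne_zero
    fun_prop
  have h := intervalIntegral.integral_eq_sub_of_hasDerivAt (a := 0) (b := 1)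
    (fun τ _ ↦ hd τ) (hc.intervalIntegrable _ _)
  simp only [one_smul, zero_smul, add_zero] at h
  rw [← h, intervalIntegral.integral_of_le zero_le_one]
  refine (enorm_integral_le_lintegral_enorm _).trans ?_
  exact lintegral_mono fun τ ↦ ContinuousLinearMap.le_opENorm _ _

theorem lintegral_scale_le {N : ℕ} (hN : 2 ≤ N) {δ : ℝ} (hδ : 0 < δ)
    {w : EuclideanSpace ℝ (Fin N)} (hw : w ≠ 0) :
    ∫⁻ τ in Ioc (0 : ℝ) 1, ENNReal.ofReal ((τ ^ (N + 1))⁻¹) *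
        (ball (0 : EuclideanSpace ℝ (Fin N)) (τ * δ)).indicator (fun w ↦ ‖w‖ₑ) w ≤
      ENNReal.ofReal (δ ^ N / N) *
        (ball (0 : EuclideanSpace ℝ (Fin N)) δ).indicator (rieszKernel N) w := by
  have hw0 : 0 < ‖w‖ := norm_pos_iff.2 hw
  have hN0 : (0 : ℝ) < N := by exact_mod_cast (by omega : 0 < N)
  by_cases hwδ : w ∈ ball (0 : EuclideanSpace ℝ (Fin N)) δ
  swap
  · rw [indicator_of_notMem hwδ, mul_zero, nonpos_iff_eq_zero,
      setLIntegral_congr_fun (g := fun _ ↦ 0) measurableSet_Ioc, lintegral_zero]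
    intro τ hτ
    have : w ∉ ball (0 : EuclideanSpace ℝ (Fin N)) (τ * δ) := fun h ↦
      hwδ (ball_subset_ball (mul_le_of_le_one_left hδ.le hτ.2) h)
    simp only [indicator_of_notMem this, mul_zero]
  rw [indicator_of_mem hwδ]
  have hc : 0 < ‖w‖ / δ := by positivity
  calc
    _ ≤ ∫⁻ τ in Ioc (0 : ℝ) 1, (Ioi (‖w‖ / δ)).indicator
          (fun τ : ℝ ↦ ENNReal.ofReal (τ ^ (-(N + 1 : ℝ)))) τ * ‖w‖ₑ := by
      refine setLIntegral_mono' measurableSet_Ioc fun τ hτ ↦ ?_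
      by_cases h : w ∈ ball (0 : EuclideanSpace ℝ (Fin N)) (τ * δ)
      · have h' : τ ∈ Ioi (‖w‖ / δ) := by
          rw [mem_Ioi, div_lt_iff₀ hδ]; simpa using h
        rw [indicator_of_mem h, indicator_of_mem h', Real.rpow_neg hτ.1.le,
          show (N + 1 : ℝ) = ((N + 1 : ℕ) : ℝ) by push_cast; rfl, Real.rpow_natCast]
      · rw [indicator_of_notMem h, mul_zero]
        exact zero_le
    _ ≤ ∫⁻ τ, (Ioi (‖w‖ / δ)).indicator
          (fun τ : ℝ ↦ ENNReal.ofReal (τ ^ (-(N + 1 : ℝ)))) τ * ‖w‖ₑ :=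
        setLIntegral_le_lintegral _ _
    _ = ENNReal.ofReal (-(‖w‖ / δ) ^ (-(N + 1 : ℝ) + 1) / (-(N + 1 : ℝ) + 1)) * ‖w‖ₑ := by
      rw [lintegral_mul_const _ (Measurable.indicator (by fun_prop) measurableSet_Ioi),
        lintegral_indicator measurableSet_Ioi,
        ← integral_Ioi_rpow_of_lt (by linarith) hc, ofReal_integral_eq_lintegral_ofReal]
      · exact integrableOn_Ioi_rpow_of_lt (by linarith) hc
      · filter_upwards [ae_restrict_mem measurableSet_Ioi] with τ hτ
        exact Real.rpow_nonneg (hc.trans hτ).le _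
    _ ≤ _ := by
      rw [rieszKernel, ← ofReal_norm, ← ENNReal.ofReal_mul' (norm_nonneg _),
        ← ENNReal.ofReal_mul (by positivity)]
      apply le_of_eq
      congr 1
      rw [show -(N + 1 : ℝ) + 1 = -(N : ℝ) by ring, Real.rpow_neg hc.le, Real.rpow_natCast]
      obtain ⟨k, rfl⟩ : ∃ k, N = k + 1 := ⟨N - 1, by omega⟩
      rw [Nat.add_sub_cancel, div_pow]
      field_simp
      ring

theorem setLIntegral_ball_sub_le {N : ℕ} (hN : 2 ≤ N) {u : EuclideanSpace ℝ (Fin N) → ℝ}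
    (hu : ContDiff ℝ 1 u) (x : EuclideanSpace ℝ (Fin N)) {δ : ℝ} (hδ : 0 < δ) :
    ∫⁻ z in ball 0 δ, ‖u (x + z) - u x‖ₑ ≤ ENNReal.ofReal (δ ^ N / N) *
      ∫⁻ y in ball 0 δ, ‖fderiv ℝ u (x + y)‖ₑ * rieszKernel N y := by
  have : Nonempty (Fin N) := ⟨⟨0, by omega⟩⟩
  have hcf := hu.continuous_fderiv one_ne_zero
  have hmF : Measurable fun w ↦ ‖fderiv ℝ u (x + w)‖ₑ := by fun_prop
  have hmi : Measurable fun p : ℝ × EuclideanSpace ℝ (Fin N) ↦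
      (ball (0 : EuclideanSpace ℝ (Fin N)) (p.1 * δ)).indicator (fun w ↦ ‖w‖ₑ) p.2 := by
    have : (fun p : ℝ × EuclideanSpace ℝ (Fin N) ↦
        (ball (0 : EuclideanSpace ℝ (Fin N)) (p.1 * δ)).indicator (fun w ↦ ‖w‖ₑ) p.2) =
        {p : ℝ × EuclideanSpace ℝ (Fin N) | ‖p.2‖ < p.1 * δ}.indicator (fun p ↦ ‖p.2‖ₑ) := by
      ext p
      simp [indicator]
    rw [this]
    exact Measurable.indicator (by fun_prop) (measurableSet_lt (by fun_prop) (by fun_prop))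
  calc
    _ ≤ ∫⁻ z in ball 0 δ, ∫⁻ τ in Ioc (0 : ℝ) 1, ‖fderiv ℝ u (x + τ • z)‖ₑ * ‖z‖ₑ :=
      lintegral_mono fun z ↦ enorm_sub_le_lintegral_fderiv hu x z
    _ = ∫⁻ τ in Ioc (0 : ℝ) 1, ∫⁻ z in ball 0 δ, ‖fderiv ℝ u (x + τ • z)‖ₑ * ‖z‖ₑ :=
      lintegral_lintegral_swap (by fun_prop)
    _ = ∫⁻ τ in Ioc (0 : ℝ) 1, ∫⁻ w, ‖fderiv ℝ u (x + w)‖ₑ * (ENNReal.ofReal ((τ ^ (N + 1))⁻¹) *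
          (ball (0 : EuclideanSpace ℝ (Fin N)) (τ * δ)).indicator (fun w ↦ ‖w‖ₑ) w) := by
      refine setLIntegral_congr_fun measurableSet_Ioc fun τ hτ ↦ ?_
      have hτ0 : 0 < τ := hτ.1
      have hm : Measurable fun w ↦ ‖fderiv ℝ u (x + w)‖ₑ * (ENNReal.ofReal τ⁻¹ *
          (ball (0 : EuclideanSpace ℝ (Fin N)) (τ * δ)).indicator (fun w ↦ ‖w‖ₑ) w) := by
        have := (hmi.comp (measurable_prodMk_left (x := τ)))
        exact hmF.mul (this.const_mul _)
      have h1 : ∀ w, ‖fderiv ℝ u (x + w)‖ₑ * (ENNReal.ofReal ((τ ^ (N + 1))⁻¹) *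
          (ball (0 : EuclideanSpace ℝ (Fin N)) (τ * δ)).indicator (fun w ↦ ‖w‖ₑ) w) =
          ENNReal.ofReal ((τ ^ N)⁻¹) * (‖fderiv ℝ u (x + w)‖ₑ * (ENNReal.ofReal τ⁻¹ *
          (ball (0 : EuclideanSpace ℝ (Fin N)) (τ * δ)).indicator (fun w ↦ ‖w‖ₑ) w)) := by
        intro w
        rw [pow_succ, mul_inv, ENNReal.ofReal_mul (by positivity)]
        ring
      simp_rw [h1]
      rw [lintegral_const_mul _ hm, ← lintegral_comp_smul_pos hm hτ0,
        ← lintegral_indicator measurableSet_ball]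
      refine lintegral_congr fun z ↦ ?_
      have h2 : τ • z ∈ ball (0 : EuclideanSpace ℝ (Fin N)) (τ * δ) ↔ z ∈ ball 0 δ := by
        simp [norm_smul, abs_of_pos hτ0, hτ0]
      by_cases hz : z ∈ ball (0 : EuclideanSpace ℝ (Fin N)) δ
      · rw [indicator_of_mem hz, indicator_of_mem (h2.2 hz), enorm_smul,
          ← mul_assoc (ENNReal.ofReal _),
          Real.enorm_eq_ofReal hτ0.le, ← ENNReal.ofReal_mul (by positivity),
          inv_mul_cancel₀ hτ0.ne', ENNReal.ofReal_one, one_mul]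
      · rw [indicator_of_notMem hz, indicator_of_notMem (h2.not.2 hz), mul_zero, mul_zero]
    _ = ∫⁻ w, ∫⁻ τ in Ioc (0 : ℝ) 1, ‖fderiv ℝ u (x + w)‖ₑ * (ENNReal.ofReal ((τ ^ (N + 1))⁻¹) *
          (ball (0 : EuclideanSpace ℝ (Fin N)) (τ * δ)).indicator (fun w ↦ ‖w‖ₑ) w) := by
      refine lintegral_lintegral_swap (Measurable.aemeasurable ?_)
      exact (by fun_prop : Measurable fun p : ℝ × EuclideanSpace ℝ (Fin N) ↦
        ‖fderiv ℝ u (x + p.2)‖ₑ).mul ((by fun_prop : Measurable fun p : ℝ × EuclideanSpace ℝ (Fin N) ↦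
          ENNReal.ofReal ((p.1 ^ (N + 1))⁻¹)).mul hmi)
    _ ≤ ∫⁻ w, ENNReal.ofReal (δ ^ N / N) * (ball (0 : EuclideanSpace ℝ (Fin N)) δ).indicator
          (fun y ↦ ‖fderiv ℝ u (x + y)‖ₑ * rieszKernel N y) w := by
      refine lintegral_mono_ae ?_
      filter_upwards [Measure.ae_ne volume (0 : EuclideanSpace ℝ (Fin N))] with w hw
      rw [lintegral_const_mul' _ _ enorm_ne_top]
      grw [lintegral_scale_le hN hδ hw]
      by_cases h : w ∈ ball (0 : EuclideanSpace ℝ (Fin N)) δ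
      · rw [indicator_of_mem h, indicator_of_mem h]
        exact le_of_eq (by ring)
      · simp [indicator_of_notMem h]
    _ = _ := by
      rw [lintegral_const_mul' _ _ ENNReal.ofReal_ne_top, lintegral_indicator measurableSet_ball]

/-- Pointwise bound of a function by its mean over a ball and a truncated Riesz potential
of its gradient. -/
theorem enorm_mul_volume_ball_le {N : ℕ} (hN : 2 ≤ N) {u : EuclideanSpace ℝ (Fin N) → ℝ}
    (hu : ContDiff ℝ 1 u) (x : EuclideanSpace ℝ (Fin N)) {δ : ℝ} (hδ : 0 < δ) :
    ‖u x‖ₑ * ENNReal.ofReal (δ ^ N * omegaN N) ≤ ENNReal.ofReal (δ ^ N / N) *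
      (∫⁻ y in ball 0 δ, ‖fderiv ℝ u (x + y)‖ₑ * rieszKernel N y) + ∫⁻ y, ‖u y‖ₑ := by
  have : Nonempty (Fin N) := ⟨⟨0, by omega⟩⟩
  have hcu : Measurable u := hu.continuous.measurable
  have hv : volume (ball (0 : EuclideanSpace ℝ (Fin N)) δ) =
      ENNReal.ofReal (δ ^ N * omegaN N) := by
    rw [Measure.addHaar_ball _ _ hδ.le, finrank_euclideanSpace, Fintype.card_fin,
      ENNReal.ofReal_mul (by positivity), ofReal_omegaN]
  rw [← hv, ← setLIntegral_const]
  calc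
    _ ≤ ∫⁻ z in ball 0 δ, (‖u (x + z) - u x‖ₑ + ‖u (x + z)‖ₑ) := by
      refine lintegral_mono fun z ↦ ?_
      rw [← enorm_neg (u (x + z) - u x)]
      refine le_trans (le_of_eq ?_) (enorm_add_le _ _)
      congr 1; ring
    _ = (∫⁻ z in ball 0 δ, ‖u (x + z) - u x‖ₑ) + ∫⁻ z in ball 0 δ, ‖u (x + z)‖ₑ :=
      lintegral_add_left (by fun_prop) _
    _ ≤ _ := by
      refine add_le_add (setLIntegral_ball_sub_le hN hu x hδ) ?_
      refine (setLIntegral_le_lintegral _ _).trans (le_of_eq ?_)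
      exact lintegral_add_left_eq_self (fun y ↦ ‖u y‖ₑ) x

theorem holderConjugate_dim {N : ℕ} (hN : 2 ≤ N) :
    (N : ℝ).HolderConjugate ((N : ℝ) / (N - 1)) := by
  have hN' : (2 : ℝ) ≤ N := by exact_mod_cast hN
  exact Real.HolderConjugate.conjExponent (by linarith)

theorem lintegral_annulus_le {N : ℕ} (hN : 2 ≤ N) {G : EuclideanSpace ℝ (Fin N) → ℝ≥0∞}
    (hG : Measurable G) (x : EuclideanSpace ℝ (Fin N)) {ρ R : ℝ} (hρ : 0 < ρ) (hR : ρ ≤ R) :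
    ∫⁻ y in ball 0 R \ ball 0 ρ, G (x + y) * rieszKernel N y ≤
      (∫⁻ y, G y ^ (N : ℝ)) ^ (1 / (N : ℝ)) *
        ENNReal.ofReal (N * omegaN N * log (R / ρ)) ^ (1 / ((N : ℝ) / (N - 1))) := by
  refine (ENNReal.lintegral_mul_le_Lp_mul_Lq _ (holderConjugate_dim hN)
    (f := fun y ↦ G (x + y)) (g := rieszKernel N) (by fun_prop) (by fun_prop)).trans ?_
  rw [setLIntegral_annulus_rieszKernel_rpow hN hρ hR]
  have h : ∫⁻ y in ball 0 R \ ball 0 ρ, G (x + y) ^ (N : ℝ) ≤ ∫⁻ y, G y ^ (N : ℝ) :=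
    (setLIntegral_le_lintegral _ _).trans_eq
      (lintegral_add_left_eq_self (fun y ↦ G y ^ (N : ℝ)) x)
  grw [h]

theorem lintegral_lintegral_ball_le {N : ℕ} (hN : 2 ≤ N) {G : EuclideanSpace ℝ (Fin N) → ℝ≥0∞}
    (hG : Measurable G) (S : Set (EuclideanSpace ℝ (Fin N))) (ρ : ℝ) :
    ∫⁻ x in S, ∫⁻ y in ball 0 ρ, G (x + y) * rieszKernel N y ≤
      (∫⁻ y, G y ^ (N : ℝ)) ^ (1 / (N : ℝ)) * ENNReal.ofReal (N * omegaN N * ρ) *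
        volume S ^ (1 / ((N : ℝ) / (N - 1))) := by
  have hN0 : (0 : ℝ) < N := by exact_mod_cast (by omega : 0 < N)
  have hc := holderConjugate_dim hN
  set q : ℝ := (N : ℝ) / (N - 1)
  set κ : Measure (EuclideanSpace ℝ (Fin N)) :=
    (volume.restrict (ball 0 ρ)).withDensity (rieszKernel N) with hκ
  have hκu : κ univ = ENNReal.ofReal (N * omegaN N * ρ) := by
    rw [hκ, withDensity_apply _ MeasurableSet.univ, Measure.restrict_univ,
      setLIntegral_ball_rieszKernel hN]
  have : IsFiniteMeasure κ := ⟨by rw [hκu]; exact ENNReal.ofReal_lt_top⟩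
  have hκG : ∀ H : EuclideanSpace ℝ (Fin N) → ℝ≥0∞, Measurable H → ∀ x,
      ∫⁻ y in ball 0 ρ, H (x + y) * rieszKernel N y = ∫⁻ y, H (x + y) ∂κ := by
    intro H hH x
    rw [hκ, lintegral_withDensity_eq_lintegral_mul _ (by fun_prop) (by fun_prop)]
    exact lintegral_congr fun y ↦ mul_comm _ _
  simp_rw [hκG G hG]
  rw [← lintegral_prod (fun p : EuclideanSpace ℝ (Fin N) × EuclideanSpace ℝ (Fin N) ↦
    G (p.1 + p.2)) (by fun_prop)]
  have hh := ENNReal.lintegral_mul_le_Lp_mul_Lq ((volume.restrict S).prod κ) hc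
    (f := fun p : EuclideanSpace ℝ (Fin N) × EuclideanSpace ℝ (Fin N) ↦ G (p.1 + p.2))
    (g := fun _ ↦ 1) (by fun_prop) (by fun_prop)
  simp only [Pi.mul_def, mul_one, ENNReal.one_rpow, lintegral_one] at hh
  refine hh.trans ?_
  have h1 : ∫⁻ p : EuclideanSpace ℝ (Fin N) × EuclideanSpace ℝ (Fin N),
      G (p.1 + p.2) ^ (N : ℝ) ∂((volume.restrict S).prod κ) ≤ (∫⁻ y, G y ^ (N : ℝ)) * κ univ := by
    rw [lintegral_prod_symm _ (by fun_prop)]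
    refine (lintegral_mono fun y ↦ ?_).trans_eq (lintegral_const _)
    refine (setLIntegral_le_lintegral _ _).trans (le_of_eq ?_)
    exact lintegral_add_right_eq_self (fun y ↦ G y ^ (N : ℝ)) y
  have h2 : ((volume.restrict S).prod κ) univ = κ univ * volume S := by
    rw [← univ_prod_univ, Measure.prod_prod, Measure.restrict_apply_univ, mul_comm]
  grw [h1]
  rw [h2, ENNReal.mul_rpow_of_nonneg _ _ (by positivity : 0 ≤ 1 / (N : ℝ)),
    ENNReal.mul_rpow_of_nonneg _ _ (one_div_nonneg.2 hc.symm.nonneg), hκu]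
  rw [show ∀ a b c d : ℝ≥0∞, a * b * (c * d) = a * (b * c) * d by intros; ring,
    ← ENNReal.rpow_add_of_nonneg _ _ (by positivity) (one_div_nonneg.2 hc.symm.nonneg)]
  have : 1 / (N : ℝ) + 1 / q = 1 := by
    have := hc.inv_add_inv_eq_one
    simpa using this
  rw [this, ENNReal.rpow_one]

/-- A bilinear estimate for the truncated Riesz potential, integrated over a set of
volume `ρ ^ N`. -/
theorem setLIntegral_rieszPotential_le {N : ℕ} (hN : 2 ≤ N)
    {G : EuclideanSpace ℝ (Fin N) → ℝ≥0∞} (hG : Measurable G)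
    {S : Set (EuclideanSpace ℝ (Fin N))} {ρ R : ℝ} (hρ : 0 < ρ) (hR : ρ ≤ R)
    (hS : volume S = ENNReal.ofReal (ρ ^ N)) :
    ∫⁻ x in S, ∫⁻ y in ball 0 R, G (x + y) * rieszKernel N y ≤
      (∫⁻ y, G y ^ (N : ℝ)) ^ (1 / (N : ℝ)) *
        ENNReal.ofReal (ρ ^ N * ((N * omegaN N * log (R / ρ)) ^ (1 - 1 / (N : ℝ)) +
          N * omegaN N)) := by
  have hN0 : (0 : ℝ) < N := by exact_mod_cast (by omega : 0 < N)
  have hω := omegaN_pos N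
  have hN' : (2 : ℝ) ≤ N := by exact_mod_cast hN
  have hq : 1 / ((N : ℝ) / (N - 1)) = 1 - 1 / (N : ℝ) := by
    field_simp [show (N : ℝ) - 1 ≠ 0 by linarith]
  have hq0 : 0 ≤ 1 - 1 / (N : ℝ) := by
    rw [sub_nonneg, div_le_one hN0]; linarith
  have hlog : 0 ≤ log (R / ρ) := Real.log_nonneg ((one_le_div hρ).2 hR)
  calc
    _ ≤ ∫⁻ x in S, ((∫⁻ y in ball 0 ρ, G (x + y) * rieszKernel N y) +
          ∫⁻ y in ball 0 R \ ball 0 ρ, G (x + y) * rieszKernel N y) := by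
      refine lintegral_mono fun x ↦ ?_
      rw [← lintegral_inter_add_sdiff _ (ball 0 R) (measurableSet_ball (x := 0) (ε := ρ))]
      gcongr
      exact inter_subset_right
    _ ≤ ∫⁻ x in S, ((∫⁻ y in ball 0 ρ, G (x + y) * rieszKernel N y) +
          (∫⁻ y, G y ^ (N : ℝ)) ^ (1 / (N : ℝ)) *
            ENNReal.ofReal (N * omegaN N * log (R / ρ)) ^ (1 / ((N : ℝ) / (N - 1)))) := by
      refine lintegral_mono fun x ↦ ?_
      gcongr
      exact lintegral_annulus_le hN hG x hρ hR
    _ ≤ (∫⁻ y, G y ^ (N : ℝ)) ^ (1 / (N : ℝ)) * ENNReal.ofReal (N * omegaN N * ρ) *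
        volume S ^ (1 / ((N : ℝ) / (N - 1))) + (∫⁻ y, G y ^ (N : ℝ)) ^ (1 / (N : ℝ)) *
            ENNReal.ofReal (N * omegaN N * log (R / ρ)) ^ (1 / ((N : ℝ) / (N - 1))) *
            volume S := by
      rw [lintegral_add_right _ measurable_const, setLIntegral_const]
      gcongr
      exact lintegral_lintegral_ball_le hN hG S ρ
    _ = _ := by
      rw [hq, hS, ENNReal.ofReal_rpow_of_nonneg (by positivity) hq0,
        ENNReal.ofReal_rpow_of_nonneg (by positivity) hq0,
        show ∀ a b c d e : ℝ≥0∞, a * b * c + a * d * e = a * (b * c + d * e) by intros; ring,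
        ← ENNReal.ofReal_mul (by positivity), ← ENNReal.ofReal_mul (by positivity),
        ← ENNReal.ofReal_add (by positivity) (by positivity)]
      congr 2
      have : (ρ ^ N) ^ (1 - 1 / (N : ℝ)) * ρ = ρ ^ N := by
        rw [← Real.rpow_natCast, ← Real.rpow_mul hρ.le]
        nth_rewrite 2 [← Real.rpow_one ρ]
        rw [← Real.rpow_add hρ]
        congr 1
        field_simp
        ring
      linear_combination (N * omegaN N) * this

theorem level_le {N : ℕ} (hN : 2 ≤ N) {u : EuclideanSpace ℝ (Fin N) → ℝ} (hu : ContDiff ℝ 1 u)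
    {δ R ρ s T U : ℝ} (hδ : 0 < δ) (hδR : δ ≤ R) (hρ : 0 < ρ) (hρR : ρ ≤ R)
    {S B : Set (EuclideanSpace ℝ (Fin N))} (hSm : MeasurableSet S) (hBm : MeasurableSet B)
    (hSB : ∀ x ∈ S, ball x δ ⊆ B) (hS : volume S = ENNReal.ofReal (ρ ^ N))
    (hsu : ∀ x ∈ S, s ≤ u x) (hT : 0 ≤ T)
    (hTB : ∫⁻ x in B, ‖fderiv ℝ u x‖ₑ ^ N ≤ ENNReal.ofReal (T ^ N))
    (hU : 0 ≤ U) (hUu : ∫⁻ x, ‖u x‖ₑ ≤ ENNReal.ofReal U) :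
    s ≤ T / (N * omegaN N) * ((N * omegaN N * log (R / ρ)) ^ (1 - 1 / (N : ℝ)) + N * omegaN N) +
      U / (δ ^ N * omegaN N) := by
  have hN0 : (0 : ℝ) < N := by exact_mod_cast (by omega : 0 < N)
  have hω := omegaN_pos N
  have hcf := hu.continuous_fderiv one_ne_zero
  have hcu := hu.continuous
  have hlog : 0 ≤ log (R / ρ) := Real.log_nonneg ((one_le_div hρ).2 hρR)
  set F : EuclideanSpace ℝ (Fin N) → ℝ≥0∞ := fun x ↦ ‖fderiv ℝ u x‖ₑ with hF
  have hFm : Measurable F := by fun_prop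
  set G := B.indicator F with hG
  have hGm : Measurable G := hFm.indicator hBm
  have hGT : (∫⁻ y, G y ^ (N : ℝ)) ^ (1 / (N : ℝ)) ≤ ENNReal.ofReal T := by
    have h1 : ∀ y, G y ^ (N : ℝ) = B.indicator (fun x ↦ F x ^ N) y := by
      intro y
      by_cases hy : y ∈ B
      · simp [hG, hy]
      · simp [hG, hy, show N ≠ 0 by omega]
    simp_rw [h1]
    rw [lintegral_indicator hBm]
    refine (ENNReal.rpow_le_rpow hTB (by positivity)).trans_eq ?_
    rw [ENNReal.ofReal_rpow_of_nonneg (by positivity) (by positivity), one_div,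
      Real.pow_rpow_inv_natCast hT (by omega)]
  set A : ℝ := (N * omegaN N * log (R / ρ)) ^ (1 - 1 / (N : ℝ)) + N * omegaN N with hA
  have hA0 : 0 ≤ A := by positivity
  have hρN : 0 < ρ ^ N := by positivity
  have key : ENNReal.ofReal (s * (δ ^ N * omegaN N) * ρ ^ N) ≤
      ENNReal.ofReal (δ ^ N / N * (T * (ρ ^ N * A)) + U * ρ ^ N) := by
    calc
      _ = ∫⁻ _ in S, ENNReal.ofReal s * ENNReal.ofReal (δ ^ N * omegaN N) := by
        rw [setLIntegral_const, hS, ← ENNReal.ofReal_mul' (by positivity),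
          ← ENNReal.ofReal_mul' (by positivity)]
      _ ≤ ∫⁻ x in S, (ENNReal.ofReal (δ ^ N / N) *
          (∫⁻ y in ball 0 R, G (x + y) * rieszKernel N y) + ∫⁻ y, ‖u y‖ₑ) := by
        refine setLIntegral_mono' hSm fun x hx ↦ ?_
        calc
          _ ≤ ‖u x‖ₑ * ENNReal.ofReal (δ ^ N * omegaN N) := by
            rw [Real.enorm_eq_ofReal_abs]
            gcongr
            exact (hsu x hx).trans (le_abs_self _)
          _ ≤ _ := enorm_mul_volume_ball_le hN hu x hδ
          _ = ENNReal.ofReal (δ ^ N / N) *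
              (∫⁻ y in ball 0 δ, G (x + y) * rieszKernel N y) + ∫⁻ y, ‖u y‖ₑ := by
            congr 2
            refine setLIntegral_congr_fun measurableSet_ball fun y hy ↦ ?_
            have : x + y ∈ B := hSB x hx (by simpa using hy)
            simp [hG, this, hF]
          _ ≤ _ := by
            gcongr
      _ = ENNReal.ofReal (δ ^ N / N) *
          (∫⁻ x in S, ∫⁻ y in ball 0 R, G (x + y) * rieszKernel N y) +
            (∫⁻ y, ‖u y‖ₑ) * volume S := by
        rw [lintegral_add_right _ measurable_const, setLIntegral_const,
          lintegral_const_mul' _ _ ENNReal.ofReal_ne_top]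
      _ ≤ ENNReal.ofReal (δ ^ N / N) * (ENNReal.ofReal T * ENNReal.ofReal (ρ ^ N * A)) +
            ENNReal.ofReal U * ENNReal.ofReal (ρ ^ N) := by
        grw [setLIntegral_rieszPotential_le hN hGm hρ hρR hS, hUu, hS, hGT]
      _ = _ := by
        rw [← ENNReal.ofReal_mul hT, ← ENNReal.ofReal_mul (by positivity),
          ← ENNReal.ofReal_mul hU, ← ENNReal.ofReal_add (by positivity) (by positivity)]
  rw [ENNReal.ofReal_le_ofReal_iff (by positivity)] at key
  rw [show T / (N * omegaN N) * A + U / (δ ^ N * omegaN N) =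
    (δ ^ N / N * (T * (ρ ^ N * A)) + U * ρ ^ N) / ((δ ^ N * omegaN N) * ρ ^ N) by field_simp]
  rw [le_div_iff₀ (by positivity)]
  linarith

theorem cN_pos {N : ℕ} (hN : 2 ≤ N) : 0 < cN N := by
  have hN' : (2 : ℝ) ≤ N := by exact_mod_cast hN
  have := omegaN_pos N
  have : (0 : ℝ) < N - 1 := by linarith
  unfold cN
  positivity

theorem young_cN {N : ℕ} (hN : 2 ≤ N) {T Λ : ℝ} (hT : 0 ≤ T) (hΛ : 0 ≤ Λ) :
    T / (N * omegaN N) * (N * omegaN N * Λ) ^ (1 - 1 / (N : ℝ)) ≤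
      N * Λ + T ^ N / (N * cN N) := by
  have hN' : (2 : ℝ) ≤ N := by exact_mod_cast hN
  have hω := omegaN_pos N
  have hN1 : (0 : ℝ) < N - 1 := by linarith
  have hc := holderConjugate_dim hN
  set D : ℝ := (N : ℝ) ^ 2 / (N - 1) with hD
  have hD0 : 0 < D := by positivity
  set θ : ℝ := 1 - 1 / (N : ℝ) with hθ
  have hθN : θ * N = ((N - 1 : ℕ) : ℝ) := by
    rw [Nat.cast_sub (by omega), hθ]; field_simp; simp
  have hθq : θ * ((N : ℝ) / (N - 1)) = 1 := by
    rw [hθ]; field_simp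
  set W : ℝ := N * omegaN N with hW
  have hW0 : 0 < W := by positivity
  have h := Real.young_inequality_of_nonneg (a := T / W * (W ^ θ / D ^ θ)) (b := (D * Λ) ^ θ)
    (by positivity) (by positivity) hc
  have e1 : ((D * Λ) ^ θ) ^ ((N : ℝ) / (N - 1)) / ((N : ℝ) / (N - 1)) = N * Λ := by
    rw [← Real.rpow_mul (by positivity), hθq, Real.rpow_one, hD]
    field_simp
  have e2 : (T / W * (W ^ θ / D ^ θ)) ^ (N : ℝ) / N = T ^ N / (N * cN N) := by
    rw [Real.mul_rpow (by positivity) (by positivity), Real.div_rpow (by positivity) (by positivity),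
      Real.div_rpow (by positivity) (by positivity), ← Real.rpow_mul hW0.le, ← Real.rpow_mul hD0.le,
      hθN, Real.rpow_natCast, Real.rpow_natCast, Real.rpow_natCast, Real.rpow_natCast, cN, ← hD]
    have : W ^ N = W ^ (N - 1) * W := by
      rw [← pow_succ, Nat.sub_add_cancel (by omega)]
    rw [this, hW]
    field_simp
  have e3 : T / W * (W ^ θ / D ^ θ) * (D * Λ) ^ θ = T / W * (W * Λ) ^ θ := by
    rw [Real.mul_rpow hD0.le hΛ, Real.mul_rpow hW0.le hΛ]
    field_simp
  rw [e1, e2, e3] at h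
  linarith

/-- Exponential decay of the volume of superlevel sets, with the sharp constant `c_N`. -/
theorem volume_superlevel_le {N : ℕ} (hN : 2 ≤ N) {u : EuclideanSpace ℝ (Fin N) → ℝ}
    (hu : ContDiff ℝ 1 u)
    {δ R s T U η : ℝ} (hδ : 0 < δ) (hδR : δ ≤ R)
    {S B : Set (EuclideanSpace ℝ (Fin N))} (hSm : MeasurableSet S) (hBm : MeasurableSet B)
    (hSB : ∀ x ∈ S, ball x δ ⊆ B) (hS : volume S ≤ ENNReal.ofReal (R ^ N))
    (hsu : ∀ x ∈ S, s ≤ u x) (hT : 0 ≤ T)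
    (hTB : ∫⁻ x in B, ‖fderiv ℝ u x‖ₑ ^ N ≤ ENNReal.ofReal (T ^ N))
    (hU : 0 ≤ U) (hUu : ∫⁻ x, ‖u x‖ₑ ≤ ENNReal.ofReal U) (hη : 0 ≤ η) :
    volume S ≤ ENNReal.ofReal (exp ((1 + η) ^ N / (N * cN N) * T ^ N + (1 + η) * T +
      (1 + η) * (U / (δ ^ N * omegaN N)) + N * log R - (1 + η) * s)) := by
  have hN0 : (0 : ℝ) < N := by exact_mod_cast (by omega : 0 < N)
  have hω := omegaN_pos N
  have hR : 0 < R := hδ.trans_le hδR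
  rcases eq_or_ne (volume S) 0 with h0 | h0
  · rw [h0]; exact zero_le
  have htop : volume S ≠ ⊤ := ne_top_of_le_ne_top ENNReal.ofReal_ne_top hS
  set v := (volume S).toReal with hv
  have hv0 : 0 < v := ENNReal.toReal_pos h0 htop
  have hSv : volume S = ENNReal.ofReal v := (ENNReal.ofReal_toReal htop).symm
  set ρ : ℝ := v ^ (1 / (N : ℝ)) with hρd
  have hρ : 0 < ρ := by positivity
  have hρN : ρ ^ N = v := by
    rw [hρd, one_div, Real.rpow_inv_natCast_pow hv0.le (by omega)]
  have hρR : ρ ≤ R := by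
    rw [hSv, ENNReal.ofReal_le_ofReal_iff (by positivity), ← hρN] at hS
    exact (pow_le_pow_iff_left₀ hρ.le hR.le (by omega)).1 hS
  have h1 := level_le hN hu hδ hδR hρ hρR hSm hBm hSB (by rw [hρN, hSv]) hsu hT hTB hU hUu
  have hlog : 0 ≤ log (R / ρ) := Real.log_nonneg ((one_le_div hρ).2 hρR)
  have h2 := young_cN hN (T := (1 + η) * T) (by positivity) hlog
  rw [Real.log_div hR.ne' hρ.ne'] at h1 h2
  have h3 : log v = N * log ρ := by rw [← hρN, Real.log_pow]
  rw [hSv]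
  apply ENNReal.ofReal_le_ofReal
  rw [← Real.log_le_iff_le_exp hv0, h3]
  have h4 := mul_le_mul_of_nonneg_left h1 (by linarith : 0 ≤ 1 + η)
  rw [mul_pow] at h2
  have e1 : T / (N * omegaN N) * (N * omegaN N) = T := by field_simp
  have e2 : (1 + η) * T / (N * omegaN N) = (1 + η) * (T / (N * omegaN N)) := by ring
  have e3 : (1 + η) ^ N * T ^ N / (N * cN N) = (1 + η) ^ N / (N * cN N) * T ^ N := by ring
  rw [e2, e3] at h2
  rw [mul_add (T / _), e1] at h4
  linarith

/-- Exponential integrability from exponential decay of superlevel sets. -/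
theorem setLIntegral_exp_le {N : ℕ} {u : EuclideanSpace ℝ (Fin N) → ℝ} (hu : Continuous u)
    {A : Set (EuclideanSpace ℝ (Fin N))} (hA : MeasurableSet A) {M η : ℝ} (hη : 0 < η)
    (h : ∀ s, 0 < s → volume (A ∩ {x | s < u x}) ≤ ENNReal.ofReal (exp (M - (1 + η) * s))) :
    ∫⁻ x in A, ENNReal.ofReal (exp (u x)) ≤ volume A + ENNReal.ofReal (exp M / η) := by
  rw [lintegral_eq_lintegral_meas_lt _ (by filter_upwards with x using (exp_pos _).le)
    (by fun_prop), ← Ioc_union_Ioi_eq_Ioi zero_le_one,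
    lintegral_union measurableSet_Ioi (Ioc_disjoint_Ioi le_rfl)]
  refine add_le_add ?_ ?_
  · refine (lintegral_mono (g := fun _ ↦ volume A) fun t ↦ ?_).trans_eq ?_
    · exact (measure_mono (subset_univ _)).trans_eq (Measure.restrict_apply_univ _)
    · simp
  · calc
      _ ≤ ∫⁻ t in Ioi (1 : ℝ), ENNReal.ofReal (exp M * t ^ (-(1 + η))) := by
        refine setLIntegral_mono' measurableSet_Ioi fun t ht ↦ ?_
        have ht0 : 0 < t := zero_lt_one.trans ht
        have hset : {x | t < exp (u x)} = {x | log t < u x} := by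
          ext x; exact (Real.log_lt_iff_lt_exp ht0).symm
        rw [hset, Measure.restrict_apply' hA, inter_comm]
        refine (h _ (Real.log_pos ht)).trans_eq ?_
        rw [Real.rpow_def_of_pos ht0, ← Real.exp_add]
        ring_nf
      _ = ENNReal.ofReal (exp M * ∫ t in Ioi (1 : ℝ), t ^ (-(1 + η))) := by
        rw [← integral_const_mul, ofReal_integral_eq_lintegral_ofReal]
        · exact (integrableOn_Ioi_rpow_of_lt (by linarith) one_pos).const_mul _
        · filter_upwards [ae_restrict_mem measurableSet_Ioi] with t ht
          have : 0 < t := zero_lt_one.trans ht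
          positivity
      _ ≤ _ := by
        rw [integral_Ioi_rpow_of_lt (by linarith) one_pos]
        apply le_of_eq
        congr 1
        rw [Real.one_rpow, show -(1 + η) + 1 = -η by ring, neg_div_neg_eq, mul_one_div]

/-- A localized Moser-Trudinger inequality with nearly sharp constant. -/
theorem setLIntegral_exp_le_of_gradient {N : ℕ} (hN : 2 ≤ N) {u : EuclideanSpace ℝ (Fin N) → ℝ}
    (hu : ContDiff ℝ 1 u) {δ R T U η : ℝ} (hδ : 0 < δ) (hδR : δ ≤ R) (hR1 : 1 ≤ R)
    {A B : Set (EuclideanSpace ℝ (Fin N))} (hA : MeasurableSet A) (hB : MeasurableSet B)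
    (hAB : ∀ x ∈ A, ball x δ ⊆ B) (hAR : volume A ≤ ENNReal.ofReal (R ^ N)) (hT : 0 ≤ T)
    (hTB : ∫⁻ x in B, ‖fderiv ℝ u x‖ₑ ^ N ≤ ENNReal.ofReal (T ^ N))
    (hU : 0 ≤ U) (hUu : ∫⁻ x, ‖u x‖ₑ ≤ ENNReal.ofReal U) (hη : 0 < η) :
    ∫⁻ x in A, ENNReal.ofReal (exp (u x)) ≤ ENNReal.ofReal ((R ^ N + 1 / η) *
      exp ((1 + η) ^ N / (N * cN N) * T ^ N + (1 + η) * T +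
        (1 + η) * (U / (δ ^ N * omegaN N)) + N * log R)) := by
  have hω := omegaN_pos N
  have hcN := cN_pos hN
  have hlog := Real.log_nonneg hR1
  set M : ℝ := (1 + η) ^ N / (N * cN N) * T ^ N + (1 + η) * T +
        (1 + η) * (U / (δ ^ N * omegaN N)) + N * log R with hM
  have hM0 : 0 ≤ M := by positivity
  have hc := hu.continuous
  refine (setLIntegral_exp_le hc hA (M := M) hη fun s _ ↦ ?_).trans ?_
  · refine volume_superlevel_le hN hu hδ hδR
      (hA.inter (measurableSet_lt measurable_const hc.measurable)) hB
      (fun x hx ↦ hAB x hx.1) ((measure_mono inter_subset_left).trans hAR)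
      (fun x hx ↦ le_of_lt hx.2) hT hTB hU hUu hη.le
  · grw [hAR]
    rw [← ENNReal.ofReal_add (by positivity) (by positivity)]
    apply ENNReal.ofReal_le_ofReal
    have h1 := Real.one_le_exp hM0
    have h2 : R ^ N ≤ R ^ N * exp M := le_mul_of_one_le_right (by positivity) h1
    calc R ^ N + exp M / η ≤ R ^ N * exp M + exp M / η := by gcongr
      _ = _ := by ring

theorem fderiv_eq_zero_of_notMem {N : ℕ} {Ω : Set (EuclideanSpace ℝ (Fin N))}
    {u : EuclideanSpace ℝ (Fin N) → ℝ} (hs : tsupport u ⊆ Ω) {x : EuclideanSpace ℝ (Fin N)}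
    (hx : x ∉ Ω) : fderiv ℝ u x = 0 := by
  by_contra h
  exact hx (hs (support_fderiv_subset ℝ h))

theorem enorm_fderiv_eq_zero_of_notMem {N : ℕ} {Ω : Set (EuclideanSpace ℝ (Fin N))}
    {u : EuclideanSpace ℝ (Fin N) → ℝ} (hs : tsupport u ⊆ Ω) {x : EuclideanSpace ℝ (Fin N)}
    (hx : x ∉ Ω) : ‖fderiv ℝ u x‖ₑ = 0 := by
  rw [fderiv_eq_zero_of_notMem hs hx, ← ofReal_norm, norm_zero, ENNReal.ofReal_zero]

/-- The `L¹` norm of a function supported in a bounded set is controlled by the `L^N` norm of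
its gradient. -/
theorem exists_lintegral_enorm_le {N : ℕ} (hN : 2 ≤ N) {Ω : Set (EuclideanSpace ℝ (Fin N))}
    (hΩo : IsOpen Ω) (hΩb : Bornology.IsBounded Ω) :
    ∃ C : ℝ, 0 ≤ C ∧ ∀ u : EuclideanSpace ℝ (Fin N) → ℝ, ContDiff ℝ 1 u → tsupport u ⊆ Ω →
      ∀ τ : ℝ, 0 ≤ τ → ∫⁻ x in Ω, ‖fderiv ℝ u x‖ₑ ^ N ≤ ENNReal.ofReal (τ ^ N) →
        ∫⁻ x, ‖u x‖ₑ ≤ ENNReal.ofReal (C * τ) := by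
  have hc := holderConjugate_dim hN
  set q : ℝ := (N : ℝ) / (N - 1)
  have hfin : volume Ω ^ (1 / q) ≠ ⊤ :=
    ENNReal.rpow_ne_top_of_nonneg (one_div_nonneg.2 hc.symm.nonneg) hΩb.measure_lt_top.ne
  set c := eLpNormLESNormFDerivOfLeConst ℝ
    (volume : Measure (EuclideanSpace ℝ (Fin N))) Ω 1 1
  refine ⟨c * (volume Ω ^ (1 / q)).toReal, by positivity, fun u hu hs τ hτ h ↦ ?_⟩
  have hm := hu.continuous_fderiv one_ne_zero
  have h1 := eLpNorm_le_eLpNorm_fderiv volume hu ((subset_tsupport u).trans hs) (p := 1) le_rfl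
    (by rw [finrank_euclideanSpace, Fintype.card_fin]; exact_mod_cast (by omega : 1 < N)) hΩb
  rw [ENNReal.coe_one, eLpNorm_one_eq_lintegral_enorm, eLpNorm_one_eq_lintegral_enorm] at h1
  have h2 : ∫⁻ x, ‖fderiv ℝ u x‖ₑ = ∫⁻ x in Ω, ‖fderiv ℝ u x‖ₑ := by
    rw [← lintegral_indicator hΩo.measurableSet]
    refine lintegral_congr fun x ↦ ?_
    by_cases hx : x ∈ Ω
    · simp [hx]
    · rw [indicator_of_notMem hx, enorm_fderiv_eq_zero_of_notMem hs hx]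
  have h3 := ENNReal.lintegral_mul_le_Lp_mul_Lq (volume.restrict Ω) hc
    (f := fun x ↦ ‖fderiv ℝ u x‖ₑ) (g := fun _ ↦ 1) (by fun_prop) (by fun_prop)
  simp only [Pi.mul_def, mul_one, ENNReal.one_rpow, lintegral_one, Measure.restrict_apply_univ,
    ENNReal.rpow_natCast] at h3
  have h4 : (∫⁻ x in Ω, ‖fderiv ℝ u x‖ₑ ^ N) ^ (1 / (N : ℝ)) ≤ ENNReal.ofReal τ := by
    refine (ENNReal.rpow_le_rpow h (by positivity)).trans_eq ?_
    rw [ENNReal.ofReal_rpow_of_nonneg (by positivity) (by positivity), one_div,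
      Real.pow_rpow_inv_natCast hτ (by omega)]
  grw [h1, h2, h3, h4]
  rw [ENNReal.ofReal_mul (by positivity), ENNReal.ofReal_mul (by positivity),
    ENNReal.ofReal_toReal hfin, ENNReal.ofReal_coe_nnreal]
  exact le_of_eq (by ring)

/-- If a measure covered by finitely many balls is not concentrated on `m` larger balls, then
`m + 1` well separated small balls carry a fixed part of it. -/
theorem exists_separated_balls {X : Type*} [PseudoMetricSpace X] [MeasurableSpace X]
    (μ : Measure X) {F : Finset X} {ρ r : ℝ} (hρr : ρ ≤ r)
    (hF : μ (⋃ p ∈ F, ball p ρ)ᶜ = 0) {c : ℝ≥0∞} {m : ℕ}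
    (hbig : ∀ S ⊆ F, S.card ≤ m → c < μ (⋃ p ∈ S, ball p r)ᶜ) :
    ∀ k ≤ m + 1, ∃ S ⊆ F, S.card = k ∧ (∀ p ∈ S, c ≤ F.card * μ (ball p ρ)) ∧
      (S : Set X).Pairwise fun p q ↦ r - ρ ≤ dist p q := by
  classical
  intro k
  induction k with
  | zero => exact fun _ ↦ ⟨∅, by simp⟩
  | succ k ih =>
    intro hk
    obtain ⟨S, hSF, hSk, hSc, hSd⟩ := ih (by omega)
    have hlt := hbig S hSF (by omega)
    set W := (⋃ p ∈ S, ball p r)ᶜ with hW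
    have hsum : μ W ≤ ∑ p ∈ F, μ (ball p ρ ∩ W) := by
      calc
        μ W ≤ μ ((⋃ p ∈ F, ball p ρ)ᶜ ∪ ⋃ p ∈ F, (ball p ρ ∩ W)) := by
          refine measure_mono fun x hx ↦ ?_
          by_cases h : x ∈ ⋃ p ∈ F, ball p ρ
          · right
            simp only [mem_iUnion] at h ⊢
            obtain ⟨p, hp, hxp⟩ := h
            exact ⟨p, hp, hxp, hx⟩
          · exact Or.inl h
        _ ≤ μ (⋃ p ∈ F, ball p ρ)ᶜ + μ (⋃ p ∈ F, (ball p ρ ∩ W)) := measure_union_le _ _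
        _ ≤ _ := by
          rw [hF, zero_add]
          exact measure_biUnion_finset_le _ _
    have hFne : F.Nonempty := by
      rw [Finset.nonempty_iff_ne_empty]
      rintro rfl
      simp only [Finset.sum_empty] at hsum
      exact absurd (hlt.trans_le hsum) not_lt_zero
    obtain ⟨p, hpF, hpmax⟩ := F.exists_max_image (fun p ↦ μ (ball p ρ ∩ W)) hFne
    have hcp : c < F.card * μ (ball p ρ ∩ W) := by
      refine (hlt.trans_le hsum).trans_le ((Finset.sum_le_card_nsmul _ _ _ hpmax).trans_eq ?_)
      rw [nsmul_eq_mul]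
    have hne : (ball p ρ ∩ W).Nonempty := by
      refine nonempty_of_measure_ne_zero (μ := μ) fun h ↦ ?_
      rw [h, mul_zero] at hcp
      exact absurd hcp not_lt_zero
    obtain ⟨x, hxp, hxW⟩ := hne
    have hdist : ∀ q ∈ S, r - ρ ≤ dist p q := by
      intro q hq
      have h1 : r ≤ dist x q := by
        by_contra h
        exact hxW (mem_biUnion hq (not_le.1 h))
      have h2 : dist x p < ρ := hxp
      linarith [dist_triangle x p q]
    have hpS : p ∉ S := fun hpS ↦
      hxW (mem_biUnion hpS (ball_subset_ball hρr hxp))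
    refine ⟨insert p S, Finset.insert_subset hpF hSF, by rw [Finset.card_insert_of_notMem hpS, hSk],
      ?_, ?_⟩
    · intro q hq
      rcases Finset.mem_insert.1 hq with rfl | hq
      · exact hcp.le.trans (by gcongr; exact inter_subset_left)
      · exact hSc q hq
    · rw [Finset.coe_insert]
      refine hSd.insert fun q hq _ ↦ ⟨hdist q hq, ?_⟩
      rw [dist_comm]
      exact hdist q hq

theorem exists_eta {N m : ℕ} {lam : ℝ} (h : lam < cN N * (m + 1)) :
    ∃ η : ℝ, 0 < η ∧ (1 + η) ^ N * lam < cN N * (m + 1) := by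
  have hc : ContinuousAt (fun η : ℝ ↦ (1 + η) ^ N * lam) 0 := by fun_prop
  have h0 : (1 + (0 : ℝ)) ^ N * lam < cN N * (m + 1) := by simpa using h
  have h1 := hc.eventually_lt continuousAt_const h0
  obtain ⟨η, hη, hη0⟩ := ((h1.filter_mono nhdsWithin_le_nhds).and
    (self_mem_nhdsWithin : Ioi (0 : ℝ) ∈ nhdsWithin 0 (Ioi 0))).exists
  exact ⟨η, hη0, hη⟩

theorem neg_le_pow_sub_mul {N : ℕ} (hN : 2 ≤ N) {a b τ : ℝ} (ha : 0 < a) (hτ : 0 ≤ τ) :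
    -(a + b ^ 2 / (4 * a)) ≤ a * τ ^ N - b * τ := by
  have h1 : τ ^ 2 - 1 ≤ τ ^ N := by
    rcases le_total 1 τ with h | h
    · linarith [pow_le_pow_right₀ h hN]
    · have := pow_le_one₀ hτ h (n := 2)
      have := pow_nonneg hτ N
      linarith
  have h2 : 0 ≤ a * (τ - b / (2 * a)) ^ 2 := by positivity
  have h3 : a * (τ - b / (2 * a)) ^ 2 = a * τ ^ 2 - b * τ + b ^ 2 / (4 * a) := by
    field_simp
    ring
  have h4 := mul_le_mul_of_nonneg_left h1 ha.le
  linarith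

theorem norm_gradient_eq {N : ℕ} (u : EuclideanSpace ℝ (Fin N) → ℝ)
    (x : EuclideanSpace ℝ (Fin N)) : ‖gradient u x‖ = ‖fderiv ℝ u x‖ := by
  rw [gradient, LinearIsometryEquiv.norm_map]

theorem setLIntegral_fderiv_pow_eq {N : ℕ} {Ω : Set (EuclideanSpace ℝ (Fin N))}
    (hΩb : Bornology.IsBounded Ω) {u : EuclideanSpace ℝ (Fin N) → ℝ}
    (hu : ContDiff ℝ 1 u) :
    ∫⁻ x in Ω, ‖fderiv ℝ u x‖ₑ ^ N =
      ENNReal.ofReal (∫ x in Ω, ‖gradient u x‖ ^ N) := by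
  have hc := hu.continuous_fderiv one_ne_zero
  simp_rw [norm_gradient_eq]
  rw [ofReal_integral_eq_lintegral_ofReal]
  · refine lintegral_congr fun x ↦ ?_
    rw [ENNReal.ofReal_pow (norm_nonneg _), ofReal_norm]
  · exact (((hc.norm.pow N).continuousOn).integrableOn_compact
      hΩb.isCompact_closure).mono_set subset_closure
  · filter_upwards with x using by positivity

theorem integrableOn_mul_exp {N : ℕ} {Ω : Set (EuclideanSpace ℝ (Fin N))} (hΩo : IsOpen Ω)
    (hΩb : Bornology.IsBounded Ω) {C₀ : ℝ} {V : EuclideanSpace ℝ (Fin N) → ℝ} (hVm : Measurable V)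
    (hV : ∀ x ∈ Ω, 0 ≤ V x ∧ V x ≤ C₀) {u : EuclideanSpace ℝ (Fin N) → ℝ} (hu : Continuous u) :
    IntegrableOn (fun x ↦ V x * exp (u x)) Ω := by
  have h1 : IntegrableOn (fun x ↦ exp (u x)) Ω :=
    ((by fun_prop : Continuous fun x ↦ exp (u x)).continuousOn.integrableOn_compact
      hΩb.isCompact_closure).mono_set subset_closure
  refine h1.bdd_mul (c := C₀) hVm.aestronglyMeasurable ?_
  filter_upwards [ae_restrict_mem hΩo.measurableSet] with x hx
  rw [Real.norm_of_nonneg (hV x hx).1]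
  exact (hV x hx).2

theorem sum_setLIntegral_ball_le {N : ℕ} {Ω : Set (EuclideanSpace ℝ (Fin N))}
    (hΩo : IsOpen Ω) {u : EuclideanSpace ℝ (Fin N) → ℝ} (hs : tsupport u ⊆ Ω) (hN : 2 ≤ N)
    {S : Finset (EuclideanSpace ℝ (Fin N))} {δ : ℝ}
    (hS : (S : Set (EuclideanSpace ℝ (Fin N))).Pairwise fun p q ↦ δ + δ ≤ dist p q) :
    ∑ p ∈ S, ∫⁻ x in ball p δ, ‖fderiv ℝ u x‖ₑ ^ N ≤ ∫⁻ x in Ω, ‖fderiv ℝ u x‖ₑ ^ N := by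
  rw [← lintegral_biUnion_finset (fun p hp q hq hpq ↦ ball_disjoint_ball (hS hp hq hpq))
    (fun _ _ ↦ measurableSet_ball), ← lintegral_indicator hΩo.measurableSet]
  refine (setLIntegral_le_lintegral _ _).trans (lintegral_mono fun x ↦ ?_)
  by_cases hx : x ∈ Ω
  · rw [indicator_of_mem hx]
  · rw [enorm_fderiv_eq_zero_of_notMem hs hx, zero_pow (by omega)]
    exact zero_le

theorem exists_fin_range_superset {X : Type*} (S : Finset X) {m : ℕ} (hS : S.card ≤ m) (x₀ : X) :
    ∃ p : Fin m → X, (∀ i, p i ∈ S ∨ p i = x₀) ∧ ∀ x ∈ S, ∃ i, p i = x := by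
  refine ⟨fun i ↦ S.toList.getD i x₀, fun i ↦ ?_, fun x hx ↦ ?_⟩
  · rcases lt_or_ge (i : ℕ) S.toList.length with h | h
    · left
      beta_reduce
      rw [List.getD_eq_getElem _ _ h]
      exact Finset.mem_toList.1 (List.getElem_mem h)
    · right
      exact List.getD_eq_default _ _ h
  · obtain ⟨i, hi, rfl⟩ := List.getElem_of_mem (Finset.mem_toList.2 hx)
    rw [Finset.length_toList] at hi
    exact ⟨⟨i, hi.trans_le hS⟩, List.getD_eq_getElem _ _ _⟩

theorem log_le_of_ofReal_mul_le {n : ℕ} {I C₀ K M ε : ℝ} (hI : 0 < I) (hC₀ : 0 < C₀) (hK : 0 < K)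
    (hε : 0 < ε)
    (h : ENNReal.ofReal (ε * I) ≤ n * (ENNReal.ofReal C₀ * ENNReal.ofReal (K * exp M))) :
    log I ≤ M + log ((n + 1) * C₀ * K / ε) := by
  rw [← ENNReal.ofReal_mul hC₀.le, ← ENNReal.ofReal_natCast, ← ENNReal.ofReal_mul (by positivity),
    ENNReal.ofReal_le_ofReal_iff (by positivity)] at h
  have h1 : I ≤ exp M * ((n + 1) * C₀ * K / ε) := by
    rw [mul_div_assoc', le_div_iff₀ hε]
    have : 0 ≤ C₀ * (K * exp M) := by positivity
    linarith
  have h2 := log_le_log hI h1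
  rwa [log_mul (exp_ne_zero _) (by positivity), log_exp] at h2

/-- Averaging the bounds on `log I` over `m + 1` disjoint balls gives a lower energy bound. -/
theorem neg_le_energy {N : ℕ} (hN : 2 ≤ N) {X : Type*} {S : Finset X} {m : ℕ}
    (hS : S.card = m + 1) {T : X → ℝ} {τ κ b d lam a l : ℝ} (hτ : 0 ≤ τ) (hκ : 0 ≤ κ)
    (hlam : 0 ≤ lam) (hT : ∑ p ∈ S, T p ^ N ≤ τ ^ N)
    (hl : ∀ p ∈ S, l ≤ κ * T p ^ N + b * τ + d)
    (ha : a = 1 / N - lam * κ / (m + 1)) (ha0 : 0 < a) :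
    -(a + (lam * b) ^ 2 / (4 * a)) - lam * d ≤ 1 / (N : ℝ) * τ ^ N - lam * l := by
  have h1 : (m + 1) * l ≤ κ * τ ^ N + (m + 1) * (b * τ + d) := by
    have h := Finset.sum_le_sum hl
    simp only [Finset.sum_const, Finset.sum_add_distrib, ← Finset.mul_sum, hS, nsmul_eq_mul] at h
    push_cast at h
    have := mul_le_mul_of_nonneg_left hT hκ
    linarith
  have h2 : l ≤ κ / (m + 1) * τ ^ N + (b * τ + d) := by
    have hm : (0 : ℝ) < m + 1 := by positivity
    rw [← mul_le_mul_iff_right₀ hm]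
    refine h1.trans_eq ?_
    field_simp
  have h3 := mul_le_mul_of_nonneg_left h2 hlam
  have h4 := neg_le_pow_sub_mul hN (b := lam * b) ha0 hτ
  have h5 : lam * (κ / (m + 1) * τ ^ N) = (1 / N - a) * τ ^ N := by
    rw [ha]
    ring
  linarith

/-- If no `m` balls of radius `r` carry most of the mass of `V e^u`, then the mass on each of
`m + 1` balls of radius `δ`, pairwise at distance at least `r - δ`, is a fixed part of the total
mass. -/
theorem exists_separated_balls_of_not_concentrated {N : ℕ} {Ω : Set (EuclideanSpace ℝ (Fin N))}
    (hΩo : IsOpen Ω) {f : EuclideanSpace ℝ (Fin N) → ℝ} (hf : IntegrableOn f Ω)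
    (hf0 : ∀ x ∈ Ω, 0 ≤ f x) {F : Finset (EuclideanSpace ℝ (Fin N))} {δ r e : ℝ} (hδr : δ ≤ r)
    (hFΩ : ∀ p ∈ F, p ∈ closure Ω) (hF : closure Ω ⊆ ⋃ p ∈ F, ball p δ) (he : 0 ≤ e) {m : ℕ}
    (hΩ : Ω.Nonempty)
    (h : ∀ p : Fin m → EuclideanSpace ℝ (Fin N), (∀ i, p i ∈ closure Ω) →
      e < ∫ x in Ω \ ⋃ i, ball (p i) r, f x) :
    ∃ S ⊆ F, S.card = m + 1 ∧
      (∀ p ∈ S, ENNReal.ofReal e ≤ F.card * ∫⁻ x in ball p δ ∩ Ω, ENNReal.ofReal (f x)) ∧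
      (S : Set (EuclideanSpace ℝ (Fin N))).Pairwise fun p q ↦ r - δ ≤ dist p q := by
  obtain ⟨x₀, hx₀⟩ := hΩ
  set μ : Measure (EuclideanSpace ℝ (Fin N)) :=
    (volume.restrict Ω).withDensity fun x ↦ ENNReal.ofReal (f x)
  have hμ : ∀ A : Set (EuclideanSpace ℝ (Fin N)), MeasurableSet A →
      μ A = ∫⁻ x in A ∩ Ω, ENNReal.ofReal (f x) := fun A hA ↦ by
    rw [withDensity_apply _ hA, Measure.restrict_restrict hA]
  have hμF : μ (⋃ p ∈ F, ball p δ)ᶜ = 0 := by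
    rw [hμ _ (Finset.measurableSet_biUnion _ fun _ _ ↦ measurableSet_ball).compl,
      (by
        rw [← disjoint_iff_inter_eq_empty, disjoint_compl_left_iff_subset]
        exact subset_closure.trans hF : (⋃ p ∈ F, ball p δ)ᶜ ∩ Ω = ∅),
      setLIntegral_empty]
  have hbig : ∀ S ⊆ F, S.card ≤ m → ENNReal.ofReal e < μ (⋃ p ∈ S, ball p r)ᶜ := by
    intro S hSF hSm
    obtain ⟨p, hp, hpS⟩ := exists_fin_range_superset S hSm x₀
    have hpΩ : ∀ i, p i ∈ closure Ω := fun i ↦ by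
      rcases hp i with h | h
      · exact hFΩ _ (hSF h)
      · rw [h]
        exact subset_closure hx₀
    have hm : MeasurableSet (⋃ i, ball (p i) r) := .iUnion fun _ ↦ measurableSet_ball
    calc
      ENNReal.ofReal e < ENNReal.ofReal (∫ x in Ω \ ⋃ i, ball (p i) r, f x) :=
        (ENNReal.ofReal_lt_ofReal_iff (he.trans_lt (h p hpΩ))).2 (h p hpΩ)
      _ = ∫⁻ x in Ω \ ⋃ i, ball (p i) r, ENNReal.ofReal (f x) := by
        refine ofReal_integral_eq_lintegral_ofReal (hf.mono_set sdiff_subset) ?_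
        filter_upwards [ae_restrict_mem (hΩo.measurableSet.diff hm)] with x hx
        exact hf0 x hx.1
      _ = μ (⋃ i, ball (p i) r)ᶜ := by
        rw [hμ _ hm.compl, inter_comm]
        rfl
      _ ≤ _ := by
        refine measure_mono (compl_subset_compl.2 (iUnion₂_subset fun x hx ↦ ?_))
        obtain ⟨i, rfl⟩ := hpS x hx
        exact subset_iUnion (fun i ↦ ball (p i) r) i
  obtain ⟨S, hSF, hSm, hSc, hSd⟩ := exists_separated_balls μ hδr hμF hbig (m + 1) le_rfl
  refine ⟨S, hSF, hSm, fun p hp ↦ ?_, hSd⟩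
  rw [← hμ _ measurableSet_ball]
  exact hSc p hp

/-- Concentration of the measure `V e^u` near `m` points for functions of very low
energy `J_λ(u) ≤ −L`, when `λ ∈ (c_N m, c_N (m+1))`. -/
theorem low_sublevels_concentrate (N : ℕ) (hN : 2 ≤ N)
    (Ω : Set (EuclideanSpace ℝ (Fin N))) (hΩo : IsOpen Ω) (hΩb : Bornology.IsBounded Ω)
    (C₀ : ℝ) (hC₀ : 1 ≤ C₀) (V : EuclideanSpace ℝ (Fin N) → ℝ) (hVm : Measurable V)
    (hV : ∀ x ∈ Ω, 1 / C₀ ≤ V x ∧ V x ≤ C₀)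
    (m : ℕ) (hm : 1 ≤ m) (lam : ℝ) (hlam₁ : cN N * m < lam) (hlam₂ : lam < cN N * (m + 1))
    (ε r : ℝ) (hε : 0 < ε) (hε1 : ε < 1) (hr : 0 < r) (hr1 : r < 1) :
    ∃ L : ℝ, 0 < L ∧
      ∀ u : EuclideanSpace ℝ (Fin N) → ℝ,
        ContDiff ℝ 1 u → HasCompactSupport u → tsupport u ⊆ Ω →
        (1 / (N : ℝ)) * (∫ x in Ω, ‖gradient u x‖ ^ N) -
            lam * Real.log (∫ x in Ω, V x * Real.exp (u x)) ≤ -L →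
        ∃ p : Fin m → EuclideanSpace ℝ (Fin N),
          (∀ i, p i ∈ closure Ω) ∧
          (∫ x in Ω \ ⋃ i, Metric.ball (p i) r, V x * Real.exp (u x)) ≤
            ε * ∫ x in Ω, V x * Real.exp (u x) := by
  have hc : 0 < cN N := cN_pos hN
  have hω := omegaN_pos N
  have hC₀' : 0 < C₀ := by linarith
  have hlam : 0 < lam := lt_of_le_of_lt (by positivity) hlam₁
  have hN0 : (0 : ℝ) < N := by exact_mod_cast (by omega : 0 < N)
  have hV0 : ∀ x ∈ Ω, 0 ≤ V x ∧ V x ≤ C₀ := fun x hx ↦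
    ⟨(by positivity : 0 ≤ 1 / C₀).trans (hV x hx).1, (hV x hx).2⟩
  obtain ⟨η, hη, hηlam⟩ := exists_eta hlam₂
  obtain ⟨δ, hδ, hδr⟩ : ∃ δ : ℝ, 0 < δ ∧ 5 * δ = r := ⟨r / 5, by positivity, by ring⟩
  obtain ⟨F, hFΩ, hF⟩ : ∃ F : Finset (EuclideanSpace ℝ (Fin N)),
      (∀ p ∈ F, p ∈ closure Ω) ∧ closure Ω ⊆ ⋃ p ∈ F, ball p δ := by
    obtain ⟨t, ht, htf, hcov⟩ := hΩb.isCompact_closure.finite_cover_balls hδ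
    exact ⟨htf.toFinset, fun p hp ↦ ht (htf.mem_toFinset.1 hp), by simpa using hcov⟩
  obtain ⟨C, hC, hCu⟩ := exists_lintegral_enorm_le hN hΩo hΩb
  set R : ℝ := 1 + (volume Ω).toReal
  have hR1 : 1 ≤ R := le_add_of_nonneg_right ENNReal.toReal_nonneg
  have hΩR : volume Ω ≤ ENNReal.ofReal (R ^ N) := by
    rw [← ENNReal.ofReal_toReal hΩb.measure_lt_top.ne]
    refine ENNReal.ofReal_le_ofReal (le_trans ?_ (le_self_pow₀ hR1 (by omega)))
    exact le_add_of_nonneg_left zero_le_one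
  set κ : ℝ := (1 + η) ^ N / (N * cN N) with hκ
  set K : ℝ := R ^ N + 1 / η
  set b : ℝ := (1 + η) * (1 + C / (δ ^ N * omegaN N)) with hb
  set d : ℝ := N * log R + log ((F.card + 1) * C₀ * K / ε) with hd
  set a : ℝ := 1 / N - lam * κ / (m + 1) with ha
  have ha0 : 0 < a := by
    rw [ha, hκ, sub_pos, mul_div_assoc', div_div, div_lt_div_iff₀ (by positivity) hN0]
    nlinarith
  refine ⟨a + (lam * b) ^ 2 / (4 * a) + |lam * d| + 1, by positivity, fun u hu _ hs hJ ↦ ?_⟩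
  by_contra! hcon
  set t : ℝ := ∫ x in Ω, ‖gradient u x‖ ^ N
  set I : ℝ := ∫ x in Ω, V x * exp (u x) with hI
  have ht : 0 ≤ t := integral_nonneg fun x ↦ by positivity
  have hVu := integrableOn_mul_exp hΩo hΩb hVm hV0 hu.continuous
  have hVu0 : ∀ x ∈ Ω, 0 ≤ V x * exp (u x) := fun x hx ↦ mul_nonneg (hV0 x hx).1 (exp_pos _).le
  have hI0 : 0 < I := by
    refine lt_of_le_of_ne (setIntegral_nonneg hΩo.measurableSet hVu0) fun h ↦ ?_
    rw [← h, log_zero] at hJ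
    have : 0 ≤ 1 / (N : ℝ) * t := by positivity
    have : 0 ≤ a + (lam * b) ^ 2 / (4 * a) + |lam * d| := by positivity
    linarith
  have hΩ : Ω.Nonempty := by
    rw [nonempty_iff_ne_empty]
    rintro rfl
    simp [hI] at hI0
  obtain ⟨S, -, hSm, hSc, hSd⟩ := exists_separated_balls_of_not_concentrated hΩo hVu hVu0
    (by linarith : δ ≤ r) hFΩ hF (by positivity : 0 ≤ ε * I) hΩ hcon
  obtain ⟨τ, hτ, hτt⟩ : ∃ τ : ℝ, 0 ≤ τ ∧ τ ^ N = t :=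
    ⟨t ^ ((N : ℝ)⁻¹), by positivity, rpow_inv_natCast_pow ht (by omega)⟩
  have hgrad : ∫⁻ x in Ω, ‖fderiv ℝ u x‖ₑ ^ N = ENNReal.ofReal (τ ^ N) := by
    rw [hτt, setLIntegral_fderiv_pow_eq hΩb hu]
  have hsum := (sum_setLIntegral_ball_le hΩo hs hN (δ := δ + δ)
    (hSd.mono' fun p q h ↦ by linarith)).trans_eq hgrad
  choose T hT hTp using fun p ↦ (⟨_, rpow_nonneg ENNReal.toReal_nonneg _,
    rpow_inv_natCast_pow ENNReal.toReal_nonneg (by omega)⟩ : ∃ T : ℝ, 0 ≤ T ∧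
      T ^ N = (∫⁻ x in ball p (δ + δ), ‖fderiv ℝ u x‖ₑ ^ N).toReal)
  have hTp' : ∀ p ∈ S, ∫⁻ x in ball p (δ + δ), ‖fderiv ℝ u x‖ₑ ^ N = ENNReal.ofReal (T p ^ N) :=
    fun p hp ↦ by
      rw [hTp, ENNReal.ofReal_toReal]
      exact ne_top_of_le_ne_top ENNReal.ofReal_ne_top
        ((Finset.single_le_sum (fun _ _ ↦ zero_le) hp).trans hsum)
  have hTsum : ∑ p ∈ S, T p ^ N ≤ τ ^ N := by
    rwa [Finset.sum_congr rfl hTp', ← ENNReal.ofReal_sum_of_nonneg fun p _ ↦ pow_nonneg (hT p) N,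
      ENNReal.ofReal_le_ofReal_iff (by positivity)] at hsum
  have hlog : ∀ p ∈ S, log I ≤ κ * T p ^ N + b * τ + d := by
    intro p hp
    have h1 := setLIntegral_exp_le_of_gradient hN hu hδ (by linarith : δ ≤ R) hR1
      (measurableSet_ball.inter hΩo.measurableSet) measurableSet_ball (A := ball p δ ∩ Ω)
      (B := ball p (δ + δ)) (fun x hx ↦ ball_subset_ball' (by gcongr; exact (mem_ball.1 hx.1).le))
      ((measure_mono inter_subset_right).trans hΩR) (hT p) (hTp' p hp).le (by positivity)
      (hCu u hu hs τ hτ hgrad.le) hη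
    have h2 : ∫⁻ x in ball p δ ∩ Ω, ENNReal.ofReal (V x * exp (u x)) ≤
        ENNReal.ofReal C₀ * ∫⁻ x in ball p δ ∩ Ω, ENNReal.ofReal (exp (u x)) := by
      rw [← lintegral_const_mul' _ _ ENNReal.ofReal_ne_top]
      refine setLIntegral_mono' (measurableSet_ball.inter hΩo.measurableSet) fun x hx ↦ ?_
      rw [← ENNReal.ofReal_mul hC₀'.le]
      have := (hV0 x hx.2).2
      gcongr
    have h3 := hSc p hp
    grw [h2, h1] at h3
    have h4 := log_le_of_ofReal_mul_le hI0 hC₀' (by positivity) hε h3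
    have h5 : T p ≤ τ :=
      le_of_pow_le_pow_left₀ (by omega) hτ
        ((Finset.single_le_sum (fun p _ ↦ pow_nonneg (hT p) N) hp).trans hTsum)
    have h6 : (1 + η) * T p ≤ (1 + η) * τ := by gcongr
    have h7 : b * τ = (1 + η) * τ + (1 + η) * (C * τ / (δ ^ N * omegaN N)) := by
      rw [hb]
      ring
    linarith
  have h := neg_le_energy hN hSm hτ (by positivity) hlam.le hTsum hlog ha ha0
  rw [hτt] at h
  linarith [le_abs_self (lam * d)]
end

section
/- Let N ≥ 2 be an integer, Ω ⊂ ℝ^N a bounded open set, δ > 0, and let χ : ℝ^N → [0,1] be a smooth function with compact support contained in Ω and χ = 1 on {x ∈ Ω : dist(x, ℝ^N∖Ω) > δ/2}; set K = {x ∈ Ω : dist(x, ℝ^N∖Ω) ≥ δ} and assume K ≠ ∅. Let C_0 ≥ 1 and V : ℝ^N → ℝ be Lipschitz with constant C_0 and satisfy 1/C_0 ≤ V(x) ≤ C_0 on the closure of Ω. Fix an integer m ≥ 1. For points p_1, …, p_m ∈ K, weights t_1, …, t_m ≥ 0 with Σ t_i = 1, and ε > 0, define φ_{ε,σ}(x)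 = χ(x) log Σ_{i=1}^{m} t_i F_N / ( (ε^{N/(N−1)} + |x−p_i|^{N/(N−1)})^N V(p_i) ), where F_N = N (N²/(N−1))^{N−1}. Then there exist constants C > 0 and ε_0 ∈ (0,1) such that (1/N) ∫_Ω |∇φ_{ε,σ}|^N dx ≤ (N/(N−1)) c_N m log(1/ε) + C for all ε ∈ (0, ε_0], all p_1,…,p_m ∈ K and all weights t_1,…,t_m as above. -/
open MeasureTheory Real Metric Set
open scoped ENNReal

noncomputable def FN (N : ℕ) : ℝ :=
  N * ((N : ℝ) ^ 2 / ((N : ℝ) - 1)) ^ (N - 1)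

/-- The test function `φ_{ε,σ}` associated to the formal barycenter
`σ = Σ tᵢ δ_{pᵢ}`, built from the standard bubbles and localized by `χ`. -/
noncomputable def testFun (N m : ℕ) (χ V : EuclideanSpace ℝ (Fin N) → ℝ)
    (p : Fin m → EuclideanSpace ℝ (Fin N)) (t : Fin m → ℝ) (ε : ℝ)
    (x : EuclideanSpace ℝ (Fin N)) : ℝ :=
  χ x * Real.log (∑ i, t i * (FN N /
    ((ε ^ ((N : ℝ) / ((N : ℝ) - 1)) + ‖x - p i‖ ^ ((N : ℝ) / ((N : ℝ) - 1))) ^ N * V (p i))))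


/-- The radial profile `1 / max y ε` has logarithmically divergent critical energy. -/
theorem integral_truncated_radial {N : ℕ} (hN : 1 ≤ N) {ε R : ℝ} (hε : 0 < ε) (hR : ε ≤ R) :
    ∫ y in (0 : ℝ)..R, y ^ (N - 1) * (1 / max y ε) ^ N = 1 / N + Real.log (R / ε) := by
  have hN0 : (N : ℝ) ≠ 0 := by positivity
  have hcont : ContinuousOn (fun y : ℝ => y ^ (N - 1) * (1 / max y ε) ^ N) univ := by
    refine Continuous.continuousOn ?_
    have : ∀ y : ℝ, max y ε ≠ 0 := fun y => (lt_max_of_lt_right hε).ne'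
    fun_prop (disch := assumption)
  have hint : ∀ a b : ℝ, IntervalIntegrable (fun y : ℝ => y ^ (N - 1) * (1 / max y ε) ^ N) volume a b :=
    fun a b => (hcont.mono (subset_univ _)).intervalIntegrable
  rw [← intervalIntegral.integral_add_adjacent_intervals (hint 0 ε) (hint ε R)]
  congr 1
  · have : ∫ y in (0 : ℝ)..ε, y ^ (N - 1) * (1 / max y ε) ^ N
        = ∫ y in (0 : ℝ)..ε, y ^ (N - 1) * (1 / ε) ^ N := by
      refine intervalIntegral.integral_congr fun y hy => ?_
      rw [uIcc_of_le hε.le] at hy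
      simp only [max_eq_right hy.2]
    rw [this, intervalIntegral.integral_mul_const, integral_pow]
    have h1 : N - 1 + 1 = N := by omega
    have h2 : ((N - 1 : ℕ) : ℝ) + 1 = N := by exact_mod_cast h1
    rw [h1, h2, zero_pow (by omega)]
    field_simp
    rw [sub_zero, one_div, ← mul_pow, mul_inv_cancel₀ hε.ne', one_pow]
  · have : ∫ y in ε..R, y ^ (N - 1) * (1 / max y ε) ^ N = ∫ y in ε..R, 1 / y := by
      refine intervalIntegral.integral_congr fun y hy => ?_
      rw [uIcc_of_le hR] at hy
      have hy0 : 0 < y := hε.trans_le hy.1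
      obtain ⟨k, rfl⟩ : ∃ k, N = k + 1 := ⟨N - 1, by omega⟩
      simp only [max_eq_left hy.1, Nat.add_sub_cancel]
      rw [pow_succ, ← mul_assoc, ← mul_pow, mul_one_div_cancel hy0.ne', one_pow, one_mul]
    rw [this, integral_one_div_of_pos hε (hε.trans_le hR)]

/-- The energy of a truncated radial profile on a set contained in a ball around its center. -/
theorem setIntegral_truncated_norm_le {N : ℕ} (hN : 1 ≤ N)
    {Ω : Set (EuclideanSpace ℝ (Fin N))} {p : EuclideanSpace ℝ (Fin N)} {ε R : ℝ}
    (hε : 0 < ε) (hR : ε ≤ R) (hΩ : Ω ⊆ closedBall p R) :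
    ∫ x in Ω, (1 / max ‖x - p‖ ε) ^ N ≤
      N * (volume (ball (0 : EuclideanSpace ℝ (Fin N)) 1)).toReal * (1 / N + Real.log (R / ε)) := by
  have : Nontrivial (EuclideanSpace ℝ (Fin N)) := by
    have : Nonempty (Fin N) := ⟨⟨0, hN⟩⟩
    infer_instance
  have hcont : Continuous fun x : EuclideanSpace ℝ (Fin N) => (1 / max ‖x - p‖ ε) ^ N := by
    have : ∀ x : EuclideanSpace ℝ (Fin N), max ‖x - p‖ ε ≠ 0 :=
      fun y => (lt_max_of_lt_right hε).ne'
    fun_prop (disch := assumption)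
  have hnn : ∀ x : EuclideanSpace ℝ (Fin N), 0 ≤ (1 / max ‖x - p‖ ε) ^ N := fun x => by
    have := lt_max_of_lt_right (b := ‖x - p‖) hε
    positivity
  calc ∫ x in Ω, (1 / max ‖x - p‖ ε) ^ N
      ≤ ∫ x in closedBall p R, (1 / max ‖x - p‖ ε) ^ N :=
        setIntegral_mono_set
          (hcont.continuousOn.integrableOn_compact (isCompact_closedBall p R))
          (Filter.Eventually.of_forall hnn) hΩ.eventuallyLE
    _ = ∫ x, (Iic R).indicator (fun y => (1 / max y ε) ^ N) ‖x - p‖ := by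
        rw [← integral_indicator measurableSet_closedBall]
        refine integral_congr_ae (Filter.Eventually.of_forall fun x => ?_)
        simp [indicator, dist_eq_norm]
    _ = ∫ x : EuclideanSpace ℝ (Fin N), (Iic R).indicator (fun y => (1 / max y ε) ^ N) ‖x‖ :=
        integral_sub_right_eq_self
          (fun x : EuclideanSpace ℝ (Fin N) => (Iic R).indicator (fun y => (1 / max y ε) ^ N) ‖x‖) p
    _ = N * (volume (ball (0 : EuclideanSpace ℝ (Fin N)) 1)).toReal * (1 / N + Real.log (R / ε)) := by
        rw [integral_fun_norm_addHaar, finrank_euclideanSpace_fin,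
          ← integral_truncated_radial hN hε hR, intervalIntegral.integral_of_le (hε.le.trans hR),
          ← Ioi_inter_Iic, ← setIntegral_indicator measurableSet_Iic, nsmul_eq_mul, smul_eq_mul,
          mul_assoc, Measure.real]
        congr 3
        ext y
        by_cases hy : y ∈ Iic R <;> simp [hy]

theorem max_mul_rpow_sub_one_le {r ε q : ℝ} (hr : 0 ≤ r) (hε : 0 < ε) (hq : 1 ≤ q) :
    max r ε * r ^ (q - 1) ≤ ε ^ q + r ^ q := by
  have h1 : 0 ≤ ε ^ q := by positivity
  have h2 : 0 ≤ r ^ q := by positivity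
  rcases le_total ε r with h | h
  · have hr0 : 0 < r := hε.trans_le h
    rw [max_eq_left h, ← Real.rpow_one_add' hr (by linarith), add_sub_cancel]
    linarith
  · rw [max_eq_right h]
    calc ε * r ^ (q - 1) ≤ ε * ε ^ (q - 1) := by
          gcongr
      _ = ε ^ q := by rw [← Real.rpow_one_add' hε.le (by linarith), add_sub_cancel]
      _ ≤ _ := by linarith

/-- A single bubble has logarithmic derivative at most `N * q / max ‖x - p‖ ε`. -/
theorem exists_hasFDerivAt_bubble {E : Type*} [NormedAddCommGroup E] [InnerProductSpace ℝ E]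
    (N : ℕ) {F v ε q : ℝ} (hF : 0 < F) (hv : 0 < v) (hε : 0 < ε) (hq : 1 < q) (p x : E) :
    ∃ D : E →L[ℝ] ℝ,
      HasFDerivAt (fun y => F / ((ε ^ q + ‖y - p‖ ^ q) ^ N * v)) D x ∧
      ‖D‖ ≤ N * q * (1 / max ‖x - p‖ ε) * (F / ((ε ^ q + ‖x - p‖ ^ q) ^ N * v)) := by
  have hw : HasFDerivAt (fun y => ε ^ q + ‖y - p‖ ^ q)
      ((fderiv ℝ (fun z : E => ‖z‖ ^ q) (x - p)).comp (ContinuousLinearMap.id ℝ E)) x := by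
    have h := (differentiable_norm_rpow (E := E) hq (x - p)).hasFDerivAt
    exact (h.comp x ((hasFDerivAt_id x).sub_const p)).const_add _
  rw [ContinuousLinearMap.comp_id] at hw
  have hw0 : 0 < ε ^ q + ‖x - p‖ ^ q := by positivity
  have hn := norm_fderiv_norm_id_rpow (x - p) hq
  have hk := max_mul_rpow_sub_one_le (norm_nonneg (x - p)) hε hq.le
  have hm : 0 < max ‖x - p‖ ε := lt_max_of_lt_right hε
  set w := ε ^ q + ‖x - p‖ ^ q
  have hs : HasDerivAt (fun s : ℝ => F / (s ^ N * v)) (-(N * F / (w ^ N * v) / w)) w := by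
    have h1 := (((hasDerivAt_pow N w).mul_const v).fun_inv
      (by positivity)).const_mul F
    simp only [← div_eq_mul_inv] at h1
    refine h1.congr_deriv ?_
    rcases N with _ | k
    · simp
    · simp only [Nat.add_sub_cancel]
      field_simp
      ring
  refine ⟨_, HasDerivAt.comp_hasFDerivAt (f := fun y => ε ^ q + ‖y - p‖ ^ q) x hs hw, ?_⟩
  rw [norm_smul, hn, norm_neg, Real.norm_of_nonneg (by positivity)]
  have h2 : ‖x - p‖ ^ (q - 1) / w ≤ 1 / max ‖x - p‖ ε := by
    rw [div_le_div_iff₀ hw0 hm]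
    linarith
  calc N * F / (w ^ N * v) / w * (q * ‖x - p‖ ^ (q - 1))
      = N * q * (‖x - p‖ ^ (q - 1) / w) * (F / (w ^ N * v)) := by ring
    _ ≤ _ := by gcongr

/-- A common bound for the logarithmic derivatives of the `u i` also bounds the logarithmic
derivative of their barycenters. -/
theorem exists_hasFDerivAt_log_sum {E ι : Type*} [NormedAddCommGroup E] [NormedSpace ℝ E]
    [Fintype ι] {u : ι → E → ℝ} {t : ι → ℝ} {x : E} {D : ι → E →L[ℝ] ℝ} {k : ι → ℝ} {K : ℝ}
    (ht : ∀ i, 0 ≤ t i) (hu : ∀ i, 0 ≤ u i x) (hS : 0 < ∑ i, t i * u i x)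
    (hD : ∀ i, HasFDerivAt (u i) (D i) x) (hDk : ∀ i, ‖D i‖ ≤ k i * u i x)
    (hkK : ∀ i, k i ≤ K) :
    ∃ L : E →L[ℝ] ℝ, HasFDerivAt (fun y => Real.log (∑ i, t i * u i y)) L x ∧ ‖L‖ ≤ K := by
  have h1 : HasFDerivAt (fun y => ∑ i, t i * u i y) (∑ i, t i • D i) x :=
    HasFDerivAt.fun_sum fun i _ => (hD i).const_mul (t i)
  refine ⟨_, h1.log hS.ne', ?_⟩
  rw [norm_smul, Real.norm_of_nonneg (by positivity), inv_mul_le_iff₀ hS, Finset.sum_mul]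
  refine (norm_sum_le _ _).trans (Finset.sum_le_sum fun i _ => ?_)
  rw [norm_smul, Real.norm_of_nonneg (ht i), mul_assoc]
  refine mul_le_mul_of_nonneg_left ((hDk i).trans ?_) (ht i)
  rw [mul_comm]
  exact mul_le_mul_of_nonneg_left (hkK i) (hu i)

theorem abs_log_le_of_mem_Icc {a b s : ℝ} (ha : 0 < a) (h : s ∈ Icc a b) :
    |Real.log s| ≤ |Real.log a| + |Real.log b| := by
  have h1 := Real.log_le_log ha h.1
  have h2 := Real.log_le_log (ha.trans_le h.1) h.2
  rw [abs_le]
  constructor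
  · linarith [neg_abs_le (Real.log a), abs_nonneg (Real.log b)]
  · linarith [le_abs_self (Real.log b), abs_nonneg (Real.log a)]

theorem sum_weights_mem_Icc {ι : Type*} [Fintype ι] {t u : ι → ℝ} {a b : ℝ}
    (ht : ∀ i, 0 ≤ t i) (ht1 : ∑ i, t i = 1) (hu : ∀ i, u i ∈ Icc a b) :
    ∑ i, t i * u i ∈ Icc a b :=
  (convex_Icc a b).sum_mem (fun i _ => ht i) ht1 fun i _ => hu i

theorem FN_pos {N : ℕ} (hN : 2 ≤ N) : 0 < FN N := by
  have h : (2 : ℝ) ≤ N := by exact_mod_cast hN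
  have h1 : (0 : ℝ) < N - 1 := by linarith
  unfold FN
  positivity

/-- Gradient bound for the logarithm of a barycenter of bubbles. -/
theorem exists_hasFDerivAt_log_bubbles {N m : ℕ} (hN : 2 ≤ N) {V : EuclideanSpace ℝ (Fin N) → ℝ}
    {p : Fin m → EuclideanSpace ℝ (Fin N)} {t : Fin m → ℝ} {ε K : ℝ} (hε : 0 < ε)
    (hV : ∀ i, 0 < V (p i)) (ht : ∀ i, 0 ≤ t i) (ht1 : ∑ i, t i = 1)
    (x : EuclideanSpace ℝ (Fin N)) (hK : ∀ i, 1 / max ‖x - p i‖ ε ≤ K) :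
    ∃ L : EuclideanSpace ℝ (Fin N) →L[ℝ] ℝ,
      HasFDerivAt (fun x => Real.log (∑ i, t i * (FN N /
        ((ε ^ ((N : ℝ) / ((N : ℝ) - 1)) + ‖x - p i‖ ^ ((N : ℝ) / ((N : ℝ) - 1))) ^ N
          * V (p i))))) L x ∧ ‖L‖ ≤ N * ((N : ℝ) / (N - 1)) * K := by
  have h : (2 : ℝ) ≤ N := by exact_mod_cast hN
  have h1 : (0 : ℝ) < N - 1 := by linarith
  have hq : 1 < (N : ℝ) / (N - 1) := by rw [one_lt_div h1]; linarith
  have hF := FN_pos hN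
  choose D hD hDk using fun i => exists_hasFDerivAt_bubble N hF (hV i) hε hq (p i) x
  have hu : ∀ i, 0 < FN N / ((ε ^ ((N : ℝ) / ((N : ℝ) - 1)) +
      ‖x - p i‖ ^ ((N : ℝ) / ((N : ℝ) - 1))) ^ N * V (p i)) := fun i => by
    have := hV i
    positivity
  refine exists_hasFDerivAt_log_sum ht (fun i => (hu i).le) ?_ hD hDk fun i => ?_
  · obtain ⟨i, -, hi⟩ : ∃ i ∈ Finset.univ, 0 < t i :=
      Finset.exists_lt_of_sum_lt (s := Finset.univ) (f := fun _ => (0 : ℝ)) (by simp [ht1])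
    exact Finset.sum_pos' (fun i _ => mul_nonneg (ht i) (hu i).le)
      ⟨i, Finset.mem_univ i, mul_pos hi (hu i)⟩
  · have := hK i
    gcongr

theorem norm_gradient_eq_norm_fderiv {E : Type*} [NormedAddCommGroup E] [InnerProductSpace ℝ E]
    [CompleteSpace E] (f : E → ℝ) (x : E) : ‖gradient f x‖ = ‖fderiv ℝ f x‖ :=
  LinearIsometryEquiv.norm_map _ _

/-- The gradient of `testFun` is controlled by truncated radial profiles around the `p i`, up to an
error which is uniform in `ε`, `p` and `t`. -/
theorem exists_gradient_testFun_bound {N : ℕ} (hN : 2 ≤ N)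
    {Ω : Set (EuclideanSpace ℝ (Fin N))} (hΩo : IsOpen Ω) (hΩb : Bornology.IsBounded Ω)
    {δ : ℝ} (hδ : 0 < δ)
    {χ : EuclideanSpace ℝ (Fin N) → ℝ} (hχsm : ContDiff ℝ (⊤ : ℕ∞) χ)
    (hχc : HasCompactSupport χ) (hχ01 : ∀ x, 0 ≤ χ x ∧ χ x ≤ 1)
    (hχ1 : ∀ x ∈ Ω, δ / 2 < Metric.infDist x Ωᶜ → χ x = 1)
    {C₀ : ℝ} (hC₀ : 1 ≤ C₀) {V : EuclideanSpace ℝ (Fin N) → ℝ}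
    (hV : ∀ x ∈ closure Ω, 1 / C₀ ≤ V x ∧ V x ≤ C₀) (m : ℕ) :
    ∃ M : ℝ, 0 ≤ M ∧ ∀ ε : ℝ, 0 < ε → ε ≤ 1 →
      ∀ (p : Fin m → EuclideanSpace ℝ (Fin N)) (t : Fin m → ℝ),
        (∀ i, p i ∈ Ω ∧ δ ≤ Metric.infDist (p i) Ωᶜ) →
        (∀ i, 0 ≤ t i) → (∑ i, t i) = 1 → ∀ x ∈ Ω,
        ‖gradient (testFun N m χ V p t ε) x‖ ^ N ≤
          (∑ i, ((N : ℝ) * (N / (N - 1))) ^ N * (1 / max ‖x - p i‖ ε) ^ N) + M ^ N := by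
  have h2 : (2 : ℝ) ≤ N := by exact_mod_cast hN
  have h1 : (0 : ℝ) < N - 1 := by linarith
  have hC₀0 : 0 < C₀ := by linarith
  have hF := FN_pos hN
  obtain ⟨B, hB⟩ := (hχc.fderiv (𝕜 := ℝ)).exists_bound_of_continuous
    (hχsm.continuous_fderiv (by simp))
  have hB0 : 0 ≤ B := (norm_nonneg _).trans (hB 0)
  set q : ℝ := (N : ℝ) / (N - 1) with hq
  have hq0 : 0 < q := by positivity
  set R : ℝ := diam Ω
  have hR : 0 ≤ R := diam_nonneg
  set a : ℝ := FN N / ((1 + R ^ q) ^ N * C₀) with ha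
  set b : ℝ := FN N / (((δ / 2) ^ q) ^ N * (1 / C₀)) with hb
  have ha0 : 0 < a := by positivity
  refine ⟨N * q * (2 / δ) + (|Real.log a| + |Real.log b|) * B, by positivity, ?_⟩
  intro ε hε hε1 p t hp ht ht1 x hx
  have hVp : ∀ i, 1 / C₀ ≤ V (p i) ∧ V (p i) ≤ C₀ := fun i => hV _ (subset_closure (hp i).1)
  have hVp0 : ∀ i, 0 < V (p i) := fun i => (by positivity : 0 < 1 / C₀).trans_le (hVp i).1
  have hm0 : ∀ i, 0 < max ‖x - p i‖ ε := fun i => lt_max_of_lt_right hε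
  rw [norm_gradient_eq_norm_fderiv]
  rcases lt_or_ge (δ / 2) (infDist x Ωᶜ) with hxd | hxd
  · have hne : Nonempty (Fin m) := by
      by_contra h
      rw [not_nonempty_iff] at h
      simp at ht1
    obtain ⟨j, hj⟩ := Finite.exists_max fun i => 1 / max ‖x - p i‖ ε
    obtain ⟨L, hL, hLn⟩ := exists_hasFDerivAt_log_bubbles hN hε hVp0 ht ht1 x hj
    have heq : testFun N m χ V p t ε =ᶠ[nhds x] fun x => Real.log (∑ i, t i * (FN N /
        ((ε ^ ((N : ℝ) / ((N : ℝ) - 1)) + ‖x - p i‖ ^ ((N : ℝ) / ((N : ℝ) - 1))) ^ N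
          * V (p i)))) := by
      filter_upwards [hΩo.mem_nhds hx,
        (continuous_infDist_pt Ωᶜ).continuousAt.eventually_const_lt hxd] with y hy hyd
      rw [testFun, hχ1 y hy hyd, one_mul]
    rw [(hL.congr_of_eventuallyEq heq).fderiv]
    calc ‖L‖ ^ N ≤ (N * q * (1 / max ‖x - p j‖ ε)) ^ N := by gcongr
      _ = (N * q) ^ N * (1 / max ‖x - p j‖ ε) ^ N := mul_pow _ _ _
      _ ≤ ∑ i, (N * q) ^ N * (1 / max ‖x - p i‖ ε) ^ N :=
        Finset.single_le_sum (f := fun i => (N * q) ^ N * (1 / max ‖x - p i‖ ε) ^ N)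
          (fun i _ => by have := hm0 i; positivity) (Finset.mem_univ j)
      _ ≤ _ := le_add_of_nonneg_right (by positivity)
  · have hfar : ∀ i, δ / 2 ≤ ‖x - p i‖ := fun i => by
      have := infDist_le_infDist_add_dist (s := Ωᶜ) (x := p i) (y := x)
      rw [dist_comm, dist_eq_norm] at this
      linarith [(hp i).2]
    have hnear : ∀ i, ‖x - p i‖ ≤ R := fun i => by
      rw [← dist_eq_norm]
      exact dist_le_diam_of_mem hΩb hx (hp i).1
    have hk : ∀ i, 1 / max ‖x - p i‖ ε ≤ 2 / δ := fun i => by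
      rw [← one_div_div δ 2]
      exact one_div_le_one_div_of_le (by positivity) ((hfar i).trans (le_max_left _ _))
    obtain ⟨L, hL, hLn⟩ := exists_hasFDerivAt_log_bubbles hN hε hVp0 ht ht1 x hk
    have hlog := abs_log_le_of_mem_Icc (b := b) ha0 <| sum_weights_mem_Icc
      (u := fun i => FN N / ((ε ^ q + ‖x - p i‖ ^ q) ^ N * V (p i))) ht ht1 fun i => by
        have hfi := hfar i
        have hni := hnear i
        have hVi := hVp i
        have hVi0 := hVp0 i
        constructor
        · have hε' : ε ^ q ≤ 1 := Real.rpow_le_one hε.le hε1 hq0.le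
          rw [ha]
          gcongr
          exact hVi.2
        · have : (δ / 2) ^ q ≤ ε ^ q + ‖x - p i‖ ^ q :=
            le_add_of_nonneg_of_le (by positivity) (by gcongr)
          rw [hb]
          gcongr
          exact hVi.1
    have hχd := ((hχsm.differentiable (by simp)) x).hasFDerivAt
    have hfd : fderiv ℝ (testFun N m χ V p t ε) x = _ := (hχd.mul hL).fderiv
    rw [hfd]
    have hχL : ‖χ x • L‖ ≤ N * q * (2 / δ) := by
      rw [norm_smul, Real.norm_of_nonneg (hχ01 x).1]
      exact (mul_le_of_le_one_left (norm_nonneg _) (hχ01 x).2).trans hLn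
    refine le_add_of_nonneg_of_le
      (Finset.sum_nonneg fun i _ => by have := hm0 i; positivity) ?_
    refine pow_le_pow_left₀ (norm_nonneg _) ((norm_add_le _ _).trans (add_le_add hχL ?_)) N
    rw [norm_smul, Real.norm_eq_abs]
    exact mul_le_mul hlog (hB x) (norm_nonneg _) (by positivity)

/-- Uniform upper bound on the Dirichlet energy of the test functions. -/
theorem bubble_energy_upper_bound (N : ℕ) (hN : 2 ≤ N)
    (Ω : Set (EuclideanSpace ℝ (Fin N))) (hΩo : IsOpen Ω) (hΩb : Bornology.IsBounded Ω)
    (δ : ℝ) (hδ : 0 < δ)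
    (χ : EuclideanSpace ℝ (Fin N) → ℝ) (hχsm : ContDiff ℝ (⊤ : ℕ∞) χ)
    (hχc : HasCompactSupport χ) (hχΩ : tsupport χ ⊆ Ω)
    (hχ01 : ∀ x, 0 ≤ χ x ∧ χ x ≤ 1)
    (hχ1 : ∀ x ∈ Ω, δ / 2 < Metric.infDist x Ωᶜ → χ x = 1)
    (hK : ∃ x ∈ Ω, δ ≤ Metric.infDist x Ωᶜ)
    (C₀ : ℝ) (hC₀ : 1 ≤ C₀) (V : EuclideanSpace ℝ (Fin N) → ℝ)
    (hVlip : LipschitzWith (Real.toNNReal C₀) V)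
    (hV : ∀ x ∈ closure Ω, 1 / C₀ ≤ V x ∧ V x ≤ C₀)
    (m : ℕ) (hm : 1 ≤ m)
    :
    ∃ C : ℝ, 0 < C ∧ ∃ ε₀ : ℝ, 0 < ε₀ ∧ ε₀ < 1 ∧
      ∀ ε : ℝ, 0 < ε → ε ≤ ε₀ →
      ∀ (p : Fin m → EuclideanSpace ℝ (Fin N)) (t : Fin m → ℝ),
        (∀ i, p i ∈ Ω ∧ δ ≤ Metric.infDist (p i) Ωᶜ) →
        (∀ i, 0 ≤ t i) → (∑ i, t i) = 1 →
        (1 / (N : ℝ)) * (∫ x in Ω, ‖gradient (testFun N m χ V p t ε) x‖ ^ N) ≤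
          ((N : ℝ) / ((N : ℝ) - 1)) * cN N * m * Real.log (1 / ε) + C := by
  have h2 : (2 : ℝ) ≤ N := by exact_mod_cast hN
  have h1 : (0 : ℝ) < N - 1 := by linarith
  obtain ⟨M, hM0, hM⟩ := exists_gradient_testFun_bound hN hΩo hΩb hδ hχsm hχc hχ01 hχ1 hC₀ hV m
  set A : ℝ := (N : ℝ) * (N / (N - 1)) with hA
  have hA0 : 0 < A := by positivity
  have hω : 0 ≤ omegaN N := ENNReal.toReal_nonneg
  set R : ℝ := max 1 (diam Ω) with hRdef
  have hR1 : 1 ≤ R := le_max_left _ _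
  have hlogR : 0 ≤ Real.log R := Real.log_nonneg hR1
  refine ⟨A ^ N * omegaN N * m * (1 / N + Real.log R) + 1 / N * (M ^ N * volume.real Ω) + 1,
    by positivity, 1 / 2, by norm_num, by norm_num, ?_⟩
  intro ε hε hε2 p t hp ht ht1
  have hε1 : ε ≤ 1 := by linarith
  have hfin : volume Ω ≠ ⊤ := hΩb.measure_lt_top.ne
  have hcont : ∀ i, Continuous fun x : EuclideanSpace ℝ (Fin N) =>
      A ^ N * (1 / max ‖x - p i‖ ε) ^ N := fun i => by
    have : ∀ x : EuclideanSpace ℝ (Fin N), max ‖x - p i‖ ε ≠ 0 :=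
      fun y => (lt_max_of_lt_right hε).ne'
    fun_prop (disch := assumption)
  have hint : ∀ i, IntegrableOn (fun x : EuclideanSpace ℝ (Fin N) =>
      A ^ N * (1 / max ‖x - p i‖ ε) ^ N) Ω := fun i =>
    ((hcont i).continuousOn.integrableOn_compact hΩb.isCompact_closure).mono_set subset_closure
  have hintM : IntegrableOn (fun _ : EuclideanSpace ℝ (Fin N) => M ^ N) Ω :=
    integrableOn_const hfin
  have hsub : ∀ i, Ω ⊆ closedBall (p i) R := fun i x hx =>
    mem_closedBall.2 ((dist_le_diam_of_mem hΩb hx (hp i).1).trans (le_max_right _ _))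
  have hmain : ∫ x in Ω, ‖gradient (testFun N m χ V p t ε) x‖ ^ N ≤
      m * (A ^ N * (N * omegaN N * (1 / N + Real.log (R / ε)))) + M ^ N * volume.real Ω := by
    calc ∫ x in Ω, ‖gradient (testFun N m χ V p t ε) x‖ ^ N
        ≤ ∫ x in Ω, ((∑ i, A ^ N * (1 / max ‖x - p i‖ ε) ^ N) + M ^ N) := by
          refine integral_mono_of_nonneg (Filter.Eventually.of_forall fun x => by positivity)
            ((integrable_finsetSum _ fun i _ => hint i).add hintM) ?_
          exact (ae_restrict_iff' hΩo.measurableSet).2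
            (Filter.Eventually.of_forall (hM ε hε hε1 p t hp ht ht1))
      _ = (∑ i, A ^ N * ∫ x in Ω, (1 / max ‖x - p i‖ ε) ^ N) + M ^ N * volume.real Ω := by
          rw [integral_add (integrable_finsetSum _ fun i _ => hint i) hintM,
            integral_finsetSum _ fun i _ => hint i]
          simp only [integral_const_mul, setIntegral_const, smul_eq_mul, mul_comm]
      _ ≤ (∑ _i : Fin m, A ^ N * (N * omegaN N * (1 / N + Real.log (R / ε))))
            + M ^ N * volume.real Ω := by
          gcongr with i
          exact setIntegral_truncated_norm_le (by omega) hε (hε1.trans hR1) (hsub i)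
      _ = _ := by simp
  have hlog : Real.log (R / ε) = Real.log R + Real.log (1 / ε) := by
    rw [div_eq_mul_one_div, Real.log_mul (by positivity) (by positivity)]
  have hc : (N : ℝ) / (N - 1) * cN N = A ^ N * omegaN N := by
    obtain ⟨k, rfl⟩ : ∃ k, N = k + 1 := ⟨N - 1, by omega⟩
    rw [cN, hA, pow_succ, Nat.add_sub_cancel]
    ring
  rw [hc]
  calc 1 / (N : ℝ) * ∫ x in Ω, ‖gradient (testFun N m χ V p t ε) x‖ ^ N
      ≤ 1 / N * (m * (A ^ N * (N * omegaN N * (1 / N + Real.log (R / ε))))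
        + M ^ N * volume.real Ω) := by gcongr
    _ = A ^ N * omegaN N * m * (1 / N + Real.log R + Real.log (1 / ε))
        + 1 / N * (M ^ N * volume.real Ω) := by
      rw [hlog]
      field_simp
      ring
    _ ≤ _ := by linarith
end
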